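/- arXiv:2210.04376 — 2 statements merged into one kernel-verified Lean document; each statement's English description precedes it below -/
import Mathlib

section
/- Let v be a bounded solution of the ODE (O6) and let t₀ ∈ ℝ. (i) If v'(t₀) = 0, then v is symmetric about t₀: v(t₀ + t) = v(t₀ - t) for all t ∈ ℝ. (ii) If v(t₀) = 0, then v is anti-symmetric about t₀: v(t₀ - t) = -v(t₀ + t) for all t ∈ ℝ. -/
noncomputable section

open Real

def cN (n : ℕ) : ℝ := (n : ℝ) * ((n : ℝ) - 6) * ((n : ℝ) ^ 4 - 20 * (n : ℝ) ^ 2 + 64) / 64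
def K0 (n : ℕ) : ℝ := ((n : ℝ) - 6) ^ 2 * ((n : ℝ) - 2) ^ 2 * ((n : ℝ) + 2) ^ 2 / 64
def K2 (n : ℕ) : ℝ := (3 * (n : ℝ) ^ 4 - 24 * (n : ℝ) ^ 3 + 72 * (n : ℝ) ^ 2 - 96 * (n : ℝ) + 304) / 16
def K4 (n : ℕ) : ℝ := (3 * (n : ℝ) ^ 2 - 12 * (n : ℝ) + 44) / 4

/-- `v` is a (classical, entire) solution of the sixth order ODE (O6). -/
def IsSolO6 (n : ℕ) (v : ℝ → ℝ) : Prop :=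
  ContDiff ℝ 6 v ∧ ∀ t : ℝ,
    iteratedDeriv 6 v t - K4 n * iteratedDeriv 4 v t + K2 n * iteratedDeriv 2 v t
      - K0 n * v t + cN n * |v t| ^ (12 / ((n : ℝ) - 6)) * v t = 0

namespace SixthOrder

open Filter Topology Set MeasureTheory
open scoped InnerProductSpace

theorem second_deriv_nonpos_of_isLocalMax {u u' : ℝ → ℝ} {t A : ℝ} (hmax : IsLocalMax u t)
    (hu : ∀ s, HasDerivAt u (u' s) s) (hu' : HasDerivAt u' A t) : A ≤ 0 := by
  by_contra! hA
  have hd : deriv u = u' := funext fun s => (hu s).deriv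
  have h0 : deriv u t = 0 := hmax.deriv_eq_zero
  have h2 : 0 < deriv (deriv u) t := by rw [hd, hu'.deriv]; exact hA
  have hmin := isLocalMin_of_deriv_deriv_pos h2 h0 (hu t).continuousAt
  have hconst : ∀ᶠ s in 𝓝 t, u s = u t := by
    filter_upwards [hmax, hmin] with s h1 h2 using le_antisymm h1 h2
  have hev : u =ᶠ[𝓝 t] fun _ => u t := hconst
  have h3 := hev.deriv.deriv_eq
  rw [hd, hu'.deriv] at h3
  simp at h3
  exact hA.ne' h3

theorem hasDerivAt_comp_abs {P P' : ℝ → ℝ} (hP : ∀ r, HasDerivAt P (P' r) r) (h0 : P' 0 = 0)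
    (t : ℝ) : HasDerivAt (fun t => P |t|) (SignType.sign t * P' |t|) t := by
  rcases lt_trichotomy t 0 with ht | rfl | ht
  · exact ((hP |t|).comp t (hasDerivAt_abs_neg ht)).congr_deriv (by simp [ht])
  · simp only [_root_.sign_zero, SignType.coe_zero, zero_mul]
    have h := hP 0
    rw [h0, hasDerivAt_iff_isLittleO_nhds_zero] at h
    rw [hasDerivAt_iff_isLittleO_nhds_zero]
    have habs : Tendsto (fun t : ℝ => |t|) (𝓝 0) (𝓝 0) := by
      simpa using (continuous_abs.tendsto (0 : ℝ))
    have := h.comp_tendsto habs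
    have := Asymptotics.isLittleO_abs_right.1 this
    simpa [Function.comp_def] using this
  · exact ((hP |t|).comp t (hasDerivAt_abs_pos ht)).congr_deriv (by simp [ht])

theorem hasDerivAt_sign_mul_comp_abs {P P' : ℝ → ℝ} (hP : ∀ r, HasDerivAt P (P' r) r)
    (h0 : P 0 = 0) (t : ℝ) :
    HasDerivAt (fun t => (SignType.sign t : ℝ) * P |t|) (P' |t|) t := by
  rcases lt_trichotomy t 0 with ht | rfl | ht
  · have h1 : HasDerivAt (fun t : ℝ => -P (-t)) (P' |t|) t := by
      refine ((hP (-t)).comp t (hasDerivAt_neg t)).neg.congr_deriv ?_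
      rw [abs_of_neg ht]; ring
    refine h1.congr_of_eventuallyEq ?_
    filter_upwards [gt_mem_nhds ht] with s hs
    simp [hs, abs_of_neg hs]
  · have h := hP 0
    rw [hasDerivAt_iff_isLittleO_nhds_zero] at h ⊢
    have habs : Tendsto (fun t : ℝ => |t|) (𝓝 0) (𝓝 0) := by
      simpa using (continuous_abs.tendsto (0 : ℝ))
    have h2 := h.comp_tendsto habs
    rw [← Asymptotics.isLittleO_norm_left] at h2 ⊢
    have h2 := Asymptotics.isLittleO_abs_right.1 h2
    refine (Asymptotics.IsBigO.of_bound 1 ?_).trans_isLittleO h2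
    filter_upwards with s
    rcases lt_trichotomy s 0 with hs | rfl | hs
    · simp only [zero_add, h0, _root_.sign_neg hs, abs_of_neg hs, abs_zero, SignType.coe_neg_one,
        smul_eq_mul, one_mul, Real.norm_eq_abs, mul_zero, sub_zero, Function.comp_def]
      rw [show P (-s) - -s * P' 0 = -(-1 * P (-s) - s * P' 0) by ring, abs_neg]
    · simp
    · simp [hs, abs_of_pos hs, h0]
  · have h1 : HasDerivAt P (P' |t|) t := by
      have := hP t
      rwa [abs_of_pos ht]
    refine h1.congr_of_eventuallyEq ?_
    filter_upwards [lt_mem_nhds ht] with s hs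
    simp [hs, abs_of_pos hs]

/-- `s 0 < s 1 < ⋯ < s p` and `u` has sign `(-1) ^ i` at `s i`. -/
def Alternates (p : ℕ) (s : ℕ → ℝ) (u : ℝ → ℝ) : Prop :=
  (∀ i < p, s i < s (i + 1)) ∧ ∀ i ≤ p, 0 < (-1 : ℝ) ^ i * u (s i)

theorem Alternates.exists_isLocalMax {p : ℕ} {s : ℕ → ℝ} {u : ℝ → ℝ} (h : Alternates p s u)
    (hc : Continuous u) (h0 : Tendsto u (cocompact ℝ) (𝓝 0)) :
    ∃ s', Alternates p s' u ∧ ∀ i ≤ p, IsLocalMax (fun t => (-1 : ℝ) ^ i * u t) (s' i) := by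
  obtain ⟨hs, hu⟩ := h
  have hpow : ∀ i : ℕ, |(-1 : ℝ) ^ i| = 1 := fun i => by simp
  have htop : Tendsto u atTop (𝓝 0) := h0.mono_left atTop_le_cocompact
  have hbot : Tendsto u atBot (𝓝 0) := h0.mono_left atBot_le_cocompact
  have hpos : ∀ i ≤ p, 0 < |u (s i)| := fun i hi => by
    have := (hu i hi).ne'
    exact abs_pos.2 (right_ne_zero_of_mul this)
  -- separating points
  have hsep : ∀ i, ∃ z, (i ≤ p + 1 → ((∀ j, j + 1 = i → s j < z ∧ (-1 : ℝ) ^ j * u z < (-1 : ℝ) ^ j * u (s j)) ∧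
      (i ≤ p → z < s i ∧ (-1 : ℝ) ^ i * u z < (-1 : ℝ) ^ i * u (s i)))) := by
    intro i
    by_cases hi : i ≤ p + 1
    swap
    · exact ⟨0, fun h => absurd h hi⟩
    rcases Nat.eq_zero_or_pos i with rfl | hi0
    · have h1 := hbot.eventually (gt_mem_nhds (hu 0 (Nat.zero_le _)))
      obtain ⟨z, hz, hz'⟩ := (h1.and (eventually_lt_atBot (s 0))).exists
      refine ⟨z, fun _ => ⟨fun j hj => by omega, fun _ => ⟨hz', ?_⟩⟩⟩
      simpa using hz
    obtain ⟨j, rfl⟩ : ∃ j, i = j + 1 := ⟨i - 1, by omega⟩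
    by_cases hj : j + 1 ≤ p
    · have h1 := hu j (by omega)
      have h2 := hu (j + 1) hj
      have hlt := hs j (by omega)
      have hcont : ContinuousOn (fun t => (-1 : ℝ) ^ j * u t) (Icc (s j) (s (j + 1))) := by fun_prop
      have hz := intermediate_value_Ioo' hlt.le hcont
      have hmem : (0 : ℝ) ∈ Ioo ((-1 : ℝ) ^ j * u (s (j + 1))) ((-1 : ℝ) ^ j * u (s j)) := by
        refine ⟨?_, h1⟩
        rw [pow_succ] at h2; linarith
      obtain ⟨z, hz1, hz2⟩ := hz hmem
      have huz : u z = 0 := by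
        rcases mul_eq_zero.1 hz2 with h | h
        · exact absurd h (by positivity)
        · exact h
      refine ⟨z, fun _ => ⟨fun k hk => ?_, fun _ => ⟨hz1.2, ?_⟩⟩⟩
      · obtain rfl : k = j := by omega
        exact ⟨hz1.1, by simpa [huz] using h1⟩
      · simpa [huz] using h2
    · have h1 : Tendsto (fun t => (-1 : ℝ) ^ j * u t) atTop (𝓝 0) := by
        simpa using htop.const_mul ((-1 : ℝ) ^ j)
      have h2 := h1.eventually (gt_mem_nhds (hu j (by omega)))
      obtain ⟨z, hz, hz'⟩ := (h2.and (eventually_gt_atTop (s j))).exists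
      refine ⟨z, fun _ => ⟨fun k hk => ?_, fun h => absurd h hj⟩⟩
      obtain rfl : k = j := by omega
      exact ⟨hz', hz⟩
  choose z hz using hsep
  have hmax : ∀ i, ∃ t, i ≤ p → z i < t ∧ t < z (i + 1) ∧ 0 < (-1 : ℝ) ^ i * u t ∧
      IsLocalMax (fun t => (-1 : ℝ) ^ i * u t) t := by
    intro i
    by_cases hi : i ≤ p
    swap
    · exact ⟨0, fun h => absurd h hi⟩
    obtain ⟨hl1, hl2⟩ := (hz i (by omega)).2 hi
    obtain ⟨hr1, hr2⟩ := (hz (i + 1) (by omega)).1 i rfl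
    obtain ⟨t, ht, htm⟩ := isCompact_Icc.exists_isMaxOn
      (s := Icc (z i) (z (i + 1))) (f := fun t => (-1 : ℝ) ^ i * u t) ⟨s i, hl1.le, hr1.le⟩
      (by fun_prop)
    have hle : (-1 : ℝ) ^ i * u (s i) ≤ (-1 : ℝ) ^ i * u t := htm ⟨hl1.le, hr1.le⟩
    have ht1 : z i < t := lt_of_le_of_ne ht.1 (by rintro rfl; linarith)
    have ht2 : t < z (i + 1) := lt_of_le_of_ne ht.2 (by rintro rfl; linarith)
    exact ⟨t, fun _ => ⟨ht1, ht2, (hu i hi).trans_le hle, htm.isLocalMax (Icc_mem_nhds ht1 ht2)⟩⟩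
  choose t ht using hmax
  refine ⟨t, ⟨fun i hi => ?_, fun i hi => (ht i hi).2.2.1⟩, fun i hi => (ht i hi).2.2.2⟩
  exact (ht i (by omega)).2.1.trans (ht (i + 1) (by omega)).1

theorem Alternates.step {p : ℕ} {s : ℕ → ℝ} {u u' v : ℝ → ℝ} {l : ℝ} (hl : l ≠ 0) (h : Alternates p s u)
    (h0 : Tendsto u (cocompact ℝ) (𝓝 0)) (hu : ∀ t, HasDerivAt u (u' t) t)
    (hu' : ∀ t, HasDerivAt u' (l ^ 2 * u t - v t) t) : ∃ s', Alternates p s' v := by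
  have hc : Continuous u := continuous_iff_continuousAt.2 fun t => (hu t).continuousAt
  obtain ⟨s', ⟨h1, h2⟩, h3⟩ := h.exists_isLocalMax hc h0
  refine ⟨s', h1, fun i hi => ?_⟩
  have := second_deriv_nonpos_of_isLocalMax (h3 i hi) (fun s => (hu s).const_mul _)
    ((hu' (s' i)).const_mul _)
  have h4 := h2 i hi
  have h5 : 0 < l ^ 2 * ((-1 : ℝ) ^ i * u (s' i)) := by positivity
  nlinarith

/-- Green kernel of `l ^ 2 - D ^ 2`. -/
def kerE (l t : ℝ) : ℝ := exp (-(l * |t|)) / (2 * l)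

/-- Green kernel of `(a ^ 2 - D ^ 2) (b ^ 2 - D ^ 2)`. -/
def kerF (a b t : ℝ) : ℝ := (kerE a t - kerE b t) / (b ^ 2 - a ^ 2)

/-- Green kernel of `(a ^ 2 - D ^ 2) (b ^ 2 - D ^ 2) (c ^ 2 - D ^ 2)`. -/
def kerG (a b c t : ℝ) : ℝ :=
  kerE a t / ((b ^ 2 - a ^ 2) * (c ^ 2 - a ^ 2)) + kerE b t / ((a ^ 2 - b ^ 2) * (c ^ 2 - b ^ 2)) +
    kerE c t / ((a ^ 2 - c ^ 2) * (b ^ 2 - c ^ 2))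

theorem kerE_neg (l t : ℝ) : kerE l (-t) = kerE l t := by simp [kerE]

theorem kerG_neg (a b c t : ℝ) : kerG a b c (-t) = kerG a b c t := by simp [kerG, kerE_neg]

theorem continuous_kerE (l : ℝ) : Continuous (kerE l) := by unfold kerE; fun_prop

theorem continuous_kerG (a b c : ℝ) : Continuous (kerG a b c) := by
  have := continuous_kerE
  unfold kerG; fun_prop

theorem tendsto_kerE {l : ℝ} (hl : 0 < l) : Tendsto (kerE l) (cocompact ℝ) (𝓝 0) := by
  have h1 : Tendsto (fun t : ℝ => l * |t|) (cocompact ℝ) atTop :=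
    (tendsto_norm_cocompact_atTop (E := ℝ)).const_mul_atTop hl
  have := (tendsto_exp_neg_atTop_nhds_zero.comp h1).div_const (2 * l)
  rw [zero_div] at this
  exact this

theorem tendsto_kerF {a b : ℝ} (ha : 0 < a) (hb : 0 < b) :
    Tendsto (kerF a b) (cocompact ℝ) (𝓝 0) := by
  have := ((tendsto_kerE ha).sub (tendsto_kerE hb)).div_const (b ^ 2 - a ^ 2)
  rw [sub_zero, zero_div] at this
  exact this

theorem tendsto_kerG {a b c : ℝ} (ha : 0 < a) (hb : 0 < b) (hc : 0 < c) :
    Tendsto (kerG a b c) (cocompact ℝ) (𝓝 0) := by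
  have := (((tendsto_kerE ha).div_const ((b ^ 2 - a ^ 2) * (c ^ 2 - a ^ 2))).add
    ((tendsto_kerE hb).div_const ((a ^ 2 - b ^ 2) * (c ^ 2 - b ^ 2)))).add
    ((tendsto_kerE hc).div_const ((a ^ 2 - c ^ 2) * (b ^ 2 - c ^ 2)))
  simp only [zero_div, add_zero] at this
  exact this

theorem exists_hasDerivAt_kerF {a b : ℝ} (ha : 0 < a) (hab : a < b) :
    ∃ F' : ℝ → ℝ, (∀ t, HasDerivAt (kerF a b) (F' t) t) ∧
      ∀ t, HasDerivAt F' (b ^ 2 * kerF a b t - kerE a t) t := by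
  have hb : 0 < b := ha.trans hab
  have hba : b ^ 2 - a ^ 2 ≠ 0 := by nlinarith
  let P : ℝ → ℝ := fun r => (exp (-(a * r)) / (2 * a) - exp (-(b * r)) / (2 * b)) / (b ^ 2 - a ^ 2)
  let P' : ℝ → ℝ := fun r => (-exp (-(a * r)) / 2 + exp (-(b * r)) / 2) / (b ^ 2 - a ^ 2)
  let P'' : ℝ → ℝ := fun r => (a * exp (-(a * r)) / 2 - b * exp (-(b * r)) / 2) / (b ^ 2 - a ^ 2)
  have he : ∀ l r : ℝ, HasDerivAt (fun r => exp (-(l * r))) (exp (-(l * r)) * (-(l * 1))) r :=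
    fun l r => ((hasDerivAt_id r).const_mul l).neg.exp
  have hP : ∀ r, HasDerivAt P (P' r) r := fun r =>
    ((((he a r).div_const (2 * a)).sub ((he b r).div_const (2 * b))).div_const _).congr_deriv (by
      simp only [P']; field_simp; ring)
  have hP' : ∀ r, HasDerivAt P' (P'' r) r := fun r =>
    ((((he a r).neg.div_const 2).add ((he b r).div_const 2)).div_const _).congr_deriv (by
      simp only [P'']; field_simp; ring)
  have h0 : P' 0 = 0 := by norm_num [P']
  refine ⟨_, hasDerivAt_comp_abs hP h0, fun t => ?_⟩
  refine (hasDerivAt_sign_mul_comp_abs hP' h0 t).congr_deriv ?_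
  simp only [P'', kerF, kerE]; field_simp; ring

theorem exists_hasDerivAt_kerG {a b c : ℝ} (ha : 0 < a) (hab : a < b) (hbc : b < c) :
    ∃ F' : ℝ → ℝ, (∀ t, HasDerivAt (kerG a b c) (F' t) t) ∧
      ∀ t, HasDerivAt F' (c ^ 2 * kerG a b c t - kerF a b t) t := by
  have hb : 0 < b := ha.trans hab
  have hc : 0 < c := hb.trans hbc
  have h1 : b ^ 2 - a ^ 2 ≠ 0 := by nlinarith
  have h2 : c ^ 2 - a ^ 2 ≠ 0 := by nlinarith
  have h3 : c ^ 2 - b ^ 2 ≠ 0 := by nlinarith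
  have h1' : a ^ 2 - b ^ 2 ≠ 0 := by nlinarith
  have h2' : a ^ 2 - c ^ 2 ≠ 0 := by nlinarith
  have h3' : b ^ 2 - c ^ 2 ≠ 0 := by nlinarith
  let d1 := (b ^ 2 - a ^ 2) * (c ^ 2 - a ^ 2)
  let d2 := (a ^ 2 - b ^ 2) * (c ^ 2 - b ^ 2)
  let d3 := (a ^ 2 - c ^ 2) * (b ^ 2 - c ^ 2)
  let P : ℝ → ℝ := fun r => exp (-(a * r)) / (2 * a) / d1 + exp (-(b * r)) / (2 * b) / d2 +
    exp (-(c * r)) / (2 * c) / d3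
  let P' : ℝ → ℝ := fun r => -exp (-(a * r)) / 2 / d1 + -exp (-(b * r)) / 2 / d2 +
    -exp (-(c * r)) / 2 / d3
  let P'' : ℝ → ℝ := fun r => a * exp (-(a * r)) / 2 / d1 + b * exp (-(b * r)) / 2 / d2 +
    c * exp (-(c * r)) / 2 / d3
  have he : ∀ l r : ℝ, HasDerivAt (fun r => exp (-(l * r))) (exp (-(l * r)) * (-(l * 1))) r :=
    fun l r => ((hasDerivAt_id r).const_mul l).neg.exp
  have hP : ∀ r, HasDerivAt P (P' r) r := fun r =>
    (((((he a r).div_const (2 * a)).div_const d1).add (((he b r).div_const (2 * b)).div_const d2)).add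
      (((he c r).div_const (2 * c)).div_const d3)).congr_deriv (by
      simp only [P']; field_simp)
  have hP' : ∀ r, HasDerivAt P' (P'' r) r := fun r =>
    (((((he a r).neg.div_const 2).div_const d1).add (((he b r).neg.div_const 2).div_const d2)).add
      (((he c r).neg.div_const 2).div_const d3)).congr_deriv (by
      simp only [P'']; field_simp)
  have h0 : P' 0 = 0 := by
    simp only [P', d1, d2, d3, mul_zero, neg_zero, exp_zero]
    field_simp; ring
  refine ⟨_, hasDerivAt_comp_abs hP h0, fun t => ?_⟩
  refine (hasDerivAt_sign_mul_comp_abs hP' h0 t).congr_deriv ?_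
  simp only [P'', kerG, kerF, kerE, d1, d2, d3]
  generalize exp (-(a * |t|)) = x
  generalize exp (-(b * |t|)) = y
  generalize exp (-(c * |t|)) = z
  field_simp; ring

theorem hasDerivAt_sum_translates {X : Finset ℝ} {k : ℝ → ℝ} {F F' : ℝ → ℝ}
    (h : ∀ t, HasDerivAt F (F' t) t) (t : ℝ) :
    HasDerivAt (fun t => ∑ x ∈ X, k x * F (t - x)) (∑ x ∈ X, k x * F' (t - x)) t := by
  refine HasDerivAt.fun_sum fun x _ => ?_
  exact ((h (t - x)).comp_sub_const t x).const_mul (k x)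

theorem tendsto_sum_translates {X : Finset ℝ} {k : ℝ → ℝ} {F : ℝ → ℝ}
    (h : Tendsto F (cocompact ℝ) (𝓝 0)) :
    Tendsto (fun t => ∑ x ∈ X, k x * F (t - x)) (cocompact ℝ) (𝓝 0) := by
  have : ∀ x ∈ X, Tendsto (fun t => k x * F (t - x)) (cocompact ℝ) (𝓝 0) := fun x _ => by
    have h1 : Tendsto (fun t : ℝ => t - x) (cocompact ℝ) (cocompact ℝ) :=
      (Homeomorph.subRight x).isClosedEmbedding.tendsto_cocompact
    simpa using (h.comp h1).const_mul (k x)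
  simpa using tendsto_finsetSum X this

theorem mem_of_isLocalMax_sum_kerE {X : Finset ℝ} {k : ℝ → ℝ} {a t : ℝ} (ha : 0 < a)
    (hmax : IsLocalMax (fun t => ∑ x ∈ X, k x * kerE a (t - x)) t)
    (hpos : 0 < ∑ x ∈ X, k x * kerE a (t - x)) : t ∈ X ∧ 0 < k t := by
  classical
  by_contra hcon
  have hk : ∀ x ∈ X, x = t → k x ≤ 0 := by
    rintro x hx rfl
    by_contra! h
    exact hcon ⟨hx, h⟩
  -- near `t`, bound each summand below by a smooth solution of `D ^ 2 q = a ^ 2 q`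
  let A : ℝ → ℝ := fun x => if x = t then k x / 2 else if x < t then 0 else k x
  let B : ℝ → ℝ := fun x => if x = t then k x / 2 else if x < t then k x else 0
  let q : ℝ → ℝ := fun s => ∑ x ∈ X, (A x * exp (a * (s - x)) + B x * exp (-(a * (s - x)))) / (2 * a)
  let q' : ℝ → ℝ := fun s =>
    ∑ x ∈ X, (A x * exp (a * (s - x)) - B x * exp (-(a * (s - x)))) / 2
  have hq : ∀ s, HasDerivAt q (q' s) s := fun s => by
    refine HasDerivAt.fun_sum fun x _ => ?_
    have h1 : HasDerivAt (fun s => a * (s - x)) (a * 1) s :=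
      ((hasDerivAt_id s).sub_const x).const_mul a
    refine (((h1.exp.const_mul (A x)).add (h1.neg.exp.const_mul (B x))).div_const (2 * a)).congr_deriv ?_
    simp only [Pi.neg_apply]
    field_simp; ring
  have hq' : ∀ s, HasDerivAt q' (a ^ 2 * q s) s := fun s => by
    simp only [q, Finset.mul_sum]
    refine HasDerivAt.fun_sum fun x _ => ?_
    have h1 : HasDerivAt (fun s => a * (s - x)) (a * 1) s :=
      ((hasDerivAt_id s).sub_const x).const_mul a
    refine (((h1.exp.const_mul (A x)).sub (h1.neg.exp.const_mul (B x))).div_const 2).congr_deriv ?_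
    simp only [Pi.neg_apply]
    field_simp; ring
  have hle : ∀ᶠ s in 𝓝 t, q s ≤ ∑ x ∈ X, k x * kerE a (s - x) := by
    have : ∀ x ∈ X, ∀ᶠ s in 𝓝 t,
        (A x * exp (a * (s - x)) + B x * exp (-(a * (s - x)))) / (2 * a) ≤ k x * kerE a (s - x) := by
      intro x hx
      rcases lt_trichotomy x t with h | h | h
      · filter_upwards [lt_mem_nhds h] with s hs
        simp only [A, B, h.ne, h, if_true, if_false, kerE, abs_of_pos (sub_pos.2 hs)]
        apply le_of_eq; ring
      · filter_upwards with s
        simp only [A, B, h, if_true, kerE]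
        have hk' := hk x hx h
        rw [h] at hk'
        have h2 : exp (-(a * |s - t|)) ≤ (exp (a * (s - t)) + exp (-(a * (s - t)))) / 2 := by
          have h3 : exp (-(a * |s - t|)) ≤ 1 := exp_le_one_iff.2 (by have := abs_nonneg (s - t); nlinarith)
          have h4 := Real.one_le_cosh (a * (s - t))
          rw [Real.cosh_eq] at h4
          linarith
        have h5 := mul_le_mul_of_nonpos_left h2 hk'
        rw [mul_div_assoc', ← sub_nonneg, ← sub_div]
        apply div_nonneg _ (by positivity)
        linarith
      · filter_upwards [gt_mem_nhds h] with s hs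
        simp only [A, B, h.ne', not_lt.2 h.le, if_false, kerE, abs_of_neg (sub_neg.2 hs)]
        apply le_of_eq
        rw [show -(a * -(s - x)) = a * (s - x) by ring]; ring
    filter_upwards [(X.eventually_all).2 this] with s hs
    exact Finset.sum_le_sum hs
  have heq : q t = ∑ x ∈ X, k x * kerE a (t - x) := by
    refine Finset.sum_congr rfl fun x _ => ?_
    rcases lt_trichotomy x t with h | h | h
    · simp only [A, B, h.ne, h, if_true, if_false, kerE, abs_of_pos (sub_pos.2 h)]; ring
    · simp [A, B, h, kerE]; ring
    · simp only [A, B, h.ne', not_lt.2 h.le, if_false, kerE, abs_of_neg (sub_neg.2 h)]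
      rw [show -(a * -(t - x)) = a * (t - x) by ring]; ring
  have hqmax : IsLocalMax q t := by
    filter_upwards [hle, hmax] with s h1 h2
    rw [heq]; exact h1.trans h2
  have := second_deriv_nonpos_of_isLocalMax hqmax hq (hq' t)
  rw [heq] at this
  have : 0 < a ^ 2 * ∑ x ∈ X, k x * kerE a (t - x) := by positivity
  linarith

theorem Alternates.strictMono {p : ℕ} {s : ℕ → ℝ} {u : ℝ → ℝ} (h : Alternates p s u) :
    ∀ i ≤ p, ∀ j < i, s j < s i := by
  intro i
  induction i with
  | zero => intro _ j hj; omega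
  | succ i ih =>
    intro hi j hj
    have h1 := h.1 i (by omega)
    rcases Nat.lt_succ_iff_lt_or_eq.1 hj with h2 | rfl
    · exact (ih (by omega) j h2).trans h1
    · exact h1

/-- A combination of `m` translates of the Green kernel changes sign at most `m - 1` times. -/
theorem Alternates.lt_card {p : ℕ} {s : ℕ → ℝ} {a b c : ℝ} (ha : 0 < a) (hab : a < b) (hbc : b < c)
    {X : Finset ℝ} {k : ℝ → ℝ} (h : Alternates p s fun t => ∑ x ∈ X, k x * kerG a b c (t - x)) :
    p < X.card := by
  have hb : 0 < b := ha.trans hab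
  have hc : 0 < c := hb.trans hbc
  obtain ⟨F', hF, hF'⟩ := exists_hasDerivAt_kerF ha hab
  obtain ⟨G', hG, hG'⟩ := exists_hasDerivAt_kerG ha hab hbc
  obtain ⟨s1, h1⟩ := h.step (l := c) (v := fun t => ∑ x ∈ X, k x * kerF a b (t - x)) hc.ne'
    (tendsto_sum_translates (tendsto_kerG ha hb hc)) (hasDerivAt_sum_translates hG) (fun t => by
      refine (hasDerivAt_sum_translates hG' t).congr_deriv ?_
      rw [Finset.mul_sum, ← Finset.sum_sub_distrib]
      exact Finset.sum_congr rfl fun x _ => by ring)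
  obtain ⟨s2, h2⟩ := h1.step (l := b) (v := fun t => ∑ x ∈ X, k x * kerE a (t - x)) hb.ne'
    (tendsto_sum_translates (tendsto_kerF ha hb)) (hasDerivAt_sum_translates hF) (fun t => by
      refine (hasDerivAt_sum_translates hF' t).congr_deriv ?_
      rw [Finset.mul_sum, ← Finset.sum_sub_distrib]
      exact Finset.sum_congr rfl fun x _ => by ring)
  have hcont : Continuous fun t => ∑ x ∈ X, k x * kerE a (t - x) := by
    have := continuous_kerE a
    fun_prop
  obtain ⟨s3, h3, h4⟩ := h2.exists_isLocalMax hcont (tendsto_sum_translates (tendsto_kerE ha))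
  have hmem : ∀ i ≤ p, s3 i ∈ X := by
    intro i hi
    have e : (fun t => (-1 : ℝ) ^ i * ∑ x ∈ X, k x * kerE a (t - x)) =
        fun t => ∑ x ∈ X, ((-1 : ℝ) ^ i * k x) * kerE a (t - x) := by
      funext t; rw [Finset.mul_sum]; exact Finset.sum_congr rfl fun x _ => by ring
    have h5 := h4 i hi
    have h6 := h3.2 i hi
    rw [e] at h5
    refine (mem_of_isLocalMax_sum_kerE ha h5 ?_).1
    rwa [← congrFun e]
  have : (Finset.range (p + 1)).card ≤ X.card := by
    refine Finset.card_le_card_of_injOn s3 (fun i hi => hmem i (by simp at hi; omega)) ?_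
    intro i hi j hj hij
    simp at hi hj
    rcases lt_trichotomy i j with h | h | h
    · exact absurd hij (h3.strictMono j (by omega) i h).ne
    · exact h
    · exact absurd hij (h3.strictMono i (by omega) j h).ne'
  simpa using this

theorem integrable_kerE {l : ℝ} (hl : 0 < l) : Integrable (kerE l) := by
  rw [← integrableOn_univ, ← Iic_union_Ioi (a := (0 : ℝ)), integrableOn_union]
  constructor
  · refine IntegrableOn.congr_fun (f := fun t => exp (l * t) / (2 * l))
      ((integrableOn_exp_mul_Iic hl 0).div_const (2 * l)) (fun t ht => ?_) measurableSet_Iic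
    simp only [kerE, abs_of_nonpos (show t ≤ 0 from ht), mul_neg, neg_neg]
  · refine IntegrableOn.congr_fun (f := fun t => exp (-l * t) / (2 * l))
      ((integrableOn_exp_mul_Ioi (neg_lt_zero.2 hl) 0).div_const (2 * l)) (fun t ht => ?_)
      measurableSet_Ioi
    simp only [kerE, abs_of_pos (show 0 < t from ht), neg_mul]

theorem integrable_mul_of_bounded {F q : ℝ → ℝ} (hF : Integrable F) (hq : Continuous q) {Q : ℝ}
    (hQ : ∀ t, |q t| ≤ Q) : Integrable fun s => F s * q s :=
  hF.mul_bdd hq.aestronglyMeasurable (ae_of_all _ hQ)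

theorem integrable_kerE_sub_mul {l : ℝ} (hl : 0 < l) {q : ℝ → ℝ} (hq : Continuous q) {Q : ℝ}
    (hQ : ∀ t, |q t| ≤ Q) (x : ℝ) : Integrable fun s => kerE l (x - s) * q s :=
  integrable_mul_of_bounded ((integrable_kerE hl).comp_sub_left x) hq hQ

theorem integrable_kerG {a b c : ℝ} (ha : 0 < a) (hb : 0 < b) (hc : 0 < c) :
    Integrable (kerG a b c) :=
  (((integrable_kerE ha).div_const _).add ((integrable_kerE hb).div_const _)).add
    ((integrable_kerE hc).div_const _)

theorem abs_integral_kernel_mul_le {F q : ℝ → ℝ} (hF : Integrable F) {Q : ℝ}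
    (hQ : ∀ t, |q t| ≤ Q) (x : ℝ) : |∫ s, F (x - s) * q s| ≤ (∫ s, |F s|) * Q := by
  rw [← integral_mul_const, ← integral_sub_left_eq_self (fun s => |F s| * Q) volume x]
  rw [← Real.norm_eq_abs]
  refine norm_integral_le_of_norm_le
    ((hF.abs.comp_sub_left x).mul_const Q) (ae_of_all _ fun s => ?_)
  rw [norm_mul]
  exact mul_le_mul_of_nonneg_left (hQ s) (norm_nonneg _)

theorem exists_eq_integral_kerE {l : ℝ} (hl : 0 < l) {e e' q : ℝ → ℝ} (hq : Continuous q) {Q : ℝ}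
    (hQ : ∀ t, |q t| ≤ Q) (he : ∀ t, HasDerivAt e (e' t) t)
    (he' : ∀ t, HasDerivAt e' (l ^ 2 * e t - q t) t) :
    ∃ α β, ∀ x, e x = (∫ s, kerE l (x - s) * q s) + (α * exp (l * x) + β * exp (-(l * x))) := by
  have hI1 : ∀ x, IntegrableOn (fun s => exp (-l * s) * q s) (Ioi x) := fun x =>
    (integrableOn_exp_mul_Ioi (neg_lt_zero.2 hl) x).mul_bdd hq.aestronglyMeasurable
      (ae_of_all _ hQ)
  have hI2 : ∀ x, IntegrableOn (fun s => exp (l * s) * q s) (Iic x) := fun x =>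
    (integrableOn_exp_mul_Iic hl x).mul_bdd hq.aestronglyMeasurable (ae_of_all _ hQ)
  have hexp : ∀ k t : ℝ, HasDerivAt (fun s => exp (k * s)) (exp (k * t) * (k * 1)) t :=
    fun k t => ((hasDerivAt_id t).const_mul k).exp
  have h1 : ∀ x, ∫ s in (0 : ℝ)..x, exp (-l * s) * q s =
      -(exp (-l * x) * (e' x + l * e x)) - -(exp (-l * 0) * (e' 0 + l * e 0)) := fun x => by
    refine intervalIntegral.integral_eq_sub_of_hasDerivAt (f := fun x => -(exp (-l * x) * (e' x + l * e x))) (fun t _ => ?_)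
      (Continuous.intervalIntegrable (by fun_prop) _ _)
    refine ((hexp (-l) t).mul ((he' t).add ((he t).const_mul l))).neg.congr_deriv ?_
    simp only [Pi.add_apply]
    ring
  have h2 : ∀ x, ∫ s in (0 : ℝ)..x, exp (l * s) * q s =
      -(exp (l * x) * (e' x - l * e x)) - -(exp (l * 0) * (e' 0 - l * e 0)) := fun x => by
    refine intervalIntegral.integral_eq_sub_of_hasDerivAt (f := fun x => -(exp (l * x) * (e' x - l * e x))) (fun t _ => ?_)
      (Continuous.intervalIntegrable (by fun_prop) _ _)
    refine ((hexp l t).mul ((he' t).sub ((he t).const_mul l))).neg.congr_deriv ?_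
    simp only [Pi.sub_apply]
    ring
  have h3 : ∀ x, ∫ s, kerE l (x - s) * q s =
      (exp (-(l * x)) * (∫ s in Iic x, exp (l * s) * q s) +
        exp (l * x) * ∫ s in Ioi x, exp (-l * s) * q s) / (2 * l) := fun x => by
    have hint := integrable_kerE_sub_mul hl hq hQ x
    rw [← setIntegral_univ, ← Iic_union_Ioi (a := x),
      setIntegral_union (Iic_disjoint_Ioi le_rfl) measurableSet_Ioi hint.integrableOn
        hint.integrableOn, ← integral_const_mul, ← integral_const_mul, add_div,
      ← integral_div, ← integral_div]
    congr 1
    · refine setIntegral_congr_fun measurableSet_Iic fun s hs => ?_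
      simp only [kerE, abs_of_nonneg (sub_nonneg.2 (show s ≤ x from hs))]
      rw [show -(l * (x - s)) = -(l * x) + l * s by ring, exp_add]; ring
    · refine setIntegral_congr_fun measurableSet_Ioi fun s hs => ?_
      simp only [kerE, abs_of_neg (sub_neg.2 (show x < s from hs))]
      rw [show -(l * -(x - s)) = l * x + -l * s by ring, exp_add]; ring
  refine ⟨((e' 0 + l * e 0) - ∫ s in Ioi 0, exp (-l * s) * q s) / (2 * l),
    -((e' 0 - l * e 0) + ∫ s in Iic 0, exp (l * s) * q s) / (2 * l), fun x => ?_⟩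
  have h4 := intervalIntegral.integral_Iic_sub_Iic (hI2 0) (hI2 x)
  have h5 := intervalIntegral.integral_Ioi_sub_Ioi' (hI1 0) (hI1 x)
  have h6 := h1 x
  have h7 := h2 x
  have e1 : exp (l * x) * exp (-(l * x)) = 1 := by rw [← exp_add]; simp
  simp only [mul_zero, exp_zero, one_mul] at h6 h7
  rw [h3, show (∫ s in Iic x, exp (l * s) * q s) = (∫ s in Iic 0, exp (l * s) * q s) +
      (-(exp (l * x) * (e' x - l * e x)) - -(e' 0 - l * e 0)) by linarith,
    show (∫ s in Ioi x, exp (-l * s) * q s) = (∫ s in Ioi 0, exp (-l * s) * q s) -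
      (-(exp (-l * x) * (e' x + l * e x)) - -(e' 0 + l * e 0)) by linarith]
  rw [show exp (-l * x) = exp (-(l * x)) by ring_nf]
  field_simp
  linear_combination (-e x * 2 * l) * e1

theorem eq_zero_of_tendsto_exp {a α : ℝ} (ha : 0 < a) {r : ℝ → ℝ}
    (hr : Tendsto (fun x => exp (-(a * x)) * r x) atTop (𝓝 0)) {M : ℝ}
    (h : ∀ x, 0 ≤ x → |α * exp (a * x) + r x| ≤ M) : α = 0 := by
  have hexp : Tendsto (fun x => exp (-(a * x))) atTop (𝓝 0) :=
    tendsto_exp_neg_atTop_nhds_zero.comp (tendsto_id.const_mul_atTop ha)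
  have h1 : Tendsto (fun x => exp (-(a * x)) * (α * exp (a * x) + r x)) atTop (𝓝 0) := by
    refine squeeze_zero_norm' (a := fun x => exp (-(a * x)) * M) ?_ (by simpa using hexp.mul_const M)
    filter_upwards [eventually_ge_atTop 0] with x hx
    rw [norm_mul, Real.norm_of_nonneg (exp_nonneg _)]
    exact mul_le_mul_of_nonneg_left (h x hx) (exp_nonneg _)
  have h2 : Tendsto (fun x => exp (-(a * x)) * (α * exp (a * x) + r x)) atTop (𝓝 (α + 0)) := by
    refine (tendsto_const_nhds.add hr).congr fun x => ?_
    have : exp (-(a * x)) * exp (a * x) = 1 := by rw [← exp_add]; simp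
    linear_combination (-α) * this
  simpa using tendsto_nhds_unique h2 h1

theorem exp_sum_coeff_eq_zero {a b c α β γ : ℝ} (ha : 0 < a) (hab : a < b) (hbc : b < c)
    {r : ℝ → ℝ} {M : ℝ} (hr : ∀ x, 0 ≤ x → |r x| ≤ M)
    (h : ∀ x, 0 ≤ x → |α * exp (a * x) + β * exp (b * x) + γ * exp (c * x) + r x| ≤ M) :
    α = 0 ∧ β = 0 ∧ γ = 0 := by
  have hexp : ∀ l, 0 < l → Tendsto (fun x => exp (-(l * x))) atTop (𝓝 0) := fun l hl =>
    tendsto_exp_neg_atTop_nhds_zero.comp (tendsto_id.const_mul_atTop hl)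
  have hR : ∀ l, 0 < l → Tendsto (fun x => exp (-(l * x)) * r x) atTop (𝓝 0) := fun l hl => by
    refine squeeze_zero_norm' (a := fun x => exp (-(l * x)) * M) ?_
      (by simpa using (hexp l hl).mul_const M)
    filter_upwards [eventually_ge_atTop 0] with x hx
    rw [norm_mul, Real.norm_of_nonneg (exp_nonneg _)]
    exact mul_le_mul_of_nonneg_left (hr x hx) (exp_nonneg _)
  have hE : ∀ k l, k < l → Tendsto (fun x => exp (-(l * x)) * exp (k * x)) atTop (𝓝 0) :=
    fun k l hkl => (hexp (l - k) (sub_pos.2 hkl)).congr fun x => by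
      rw [← exp_add]; congr 1; ring
  have hγ : γ = 0 := by
    refine eq_zero_of_tendsto_exp (a := c) (M := M) (by linarith)
      (r := fun x => α * exp (a * x) + β * exp (b * x) + r x) ?_ fun x hx => ?_
    · have := (((hE a c (by linarith)).const_mul α).add ((hE b c hbc).const_mul β)).add
        (hR c (by linarith))
      simp only [mul_zero, add_zero] at this
      exact this.congr fun x => by ring
    · convert h x hx using 2; ring
  subst hγ
  have hβ : β = 0 := by
    refine eq_zero_of_tendsto_exp (a := b) (M := M) (by linarith)
      (r := fun x => α * exp (a * x) + r x) ?_ fun x hx => ?_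
    · have := ((hE a b hab).const_mul α).add (hR b (by linarith))
      simp only [mul_zero, add_zero] at this
      exact this.congr fun x => by ring
    · convert h x hx using 2; ring
  subst hβ
  refine ⟨?_, rfl, rfl⟩
  refine eq_zero_of_tendsto_exp (a := a) (M := M) ha (r := r) (hR a ha) fun x hx => ?_
  convert h x hx using 2; ring

theorem eq_zero_of_bounded_exp_sum {a b c : ℝ} (ha : 0 < a) (hab : a < b) (hbc : b < c)
    {α β γ α' β' γ' M : ℝ}
    (h : ∀ x, |(α * exp (a * x) + α' * exp (-(a * x))) + (β * exp (b * x) + β' * exp (-(b * x))) +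
      (γ * exp (c * x) + γ' * exp (-(c * x)))| ≤ M) :
    (α = 0 ∧ β = 0 ∧ γ = 0) ∧ α' = 0 ∧ β' = 0 ∧ γ' = 0 := by
  have hle : ∀ l x, 0 < l → 0 ≤ x → ∀ d : ℝ, |d * exp (-(l * x))| ≤ |d| := fun l x hl hx d => by
    rw [abs_mul, abs_of_pos (exp_pos _)]
    exact mul_le_of_le_one_right (abs_nonneg _) (exp_le_one_iff.2 (by have := mul_nonneg hl.le hx; linarith))
  have hb : 0 < b := ha.trans hab
  have hc : 0 < c := hb.trans hbc
  have hbd : ∀ d e f : ℝ, ∀ x, 0 ≤ x →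
      |d * exp (-(a * x)) + e * exp (-(b * x)) + f * exp (-(c * x))| ≤ |d| + |e| + |f| := by
    intro d e f x hx
    exact (abs_add_three _ _ _).trans (add_le_add (add_le_add (hle a x ha hx d) (hle b x hb hx e)) (hle c x hc hx f))
  constructor
  · refine exp_sum_coeff_eq_zero ha hab hbc (M := max M (|α'| + |β'| + |γ'|))
      (r := fun x => α' * exp (-(a * x)) + β' * exp (-(b * x)) + γ' * exp (-(c * x)))
      (fun x hx => (hbd _ _ _ x hx).trans (le_max_right _ _)) fun x hx => ?_
    refine le_trans (le_of_eq ?_) ((h x).trans (le_max_left _ _))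
    congr 1; ring
  · refine exp_sum_coeff_eq_zero ha hab hbc (M := max M (|α| + |β| + |γ|))
      (r := fun x => α * exp (-(a * x)) + β * exp (-(b * x)) + γ * exp (-(c * x)))
      (fun x hx => (hbd _ _ _ x hx).trans (le_max_right _ _)) fun x hx => ?_
    refine le_trans (le_of_eq ?_) ((h (-x)).trans (le_max_left _ _))
    simp only [mul_neg, neg_neg]
    congr 1; ring

/-- Bounded solutions of `(a ^ 2 - D ^ 2) (b ^ 2 - D ^ 2) (c ^ 2 - D ^ 2) y = q` are given by
convolution with the Green kernel. -/
theorem eq_integral_kerG {a b c : ℝ} (ha : 0 < a) (hab : a < b) (hbc : b < c) {y : ℕ → ℝ → ℝ}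
    {q : ℝ → ℝ} (hq : Continuous q) {Q : ℝ} (hQ : ∀ t, |q t| ≤ Q) {M : ℝ} (hM : ∀ t, |y 0 t| ≤ M)
    (hy : ∀ j < 6, ∀ t, HasDerivAt (y j) (y (j + 1) t) t)
    (heq : ∀ t, y 6 t - (a ^ 2 + b ^ 2 + c ^ 2) * y 4 t +
      (a ^ 2 * b ^ 2 + a ^ 2 * c ^ 2 + b ^ 2 * c ^ 2) * y 2 t - a ^ 2 * b ^ 2 * c ^ 2 * y 0 t = -q t)
    (x : ℝ) : y 0 x = ∫ s, kerG a b c (x - s) * q s := by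
  have hb : 0 < b := ha.trans hab
  have hc : 0 < c := hb.trans hbc
  have main : ∀ l k m : ℝ, 0 < l → l ^ 2 + k ^ 2 + m ^ 2 = a ^ 2 + b ^ 2 + c ^ 2 →
      l ^ 2 * k ^ 2 + l ^ 2 * m ^ 2 + k ^ 2 * m ^ 2 =
        a ^ 2 * b ^ 2 + a ^ 2 * c ^ 2 + b ^ 2 * c ^ 2 →
      l ^ 2 * k ^ 2 * m ^ 2 = a ^ 2 * b ^ 2 * c ^ 2 →
      ∃ α β, ∀ x, y 4 x - (k ^ 2 + m ^ 2) * y 2 x + k ^ 2 * m ^ 2 * y 0 x =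
        (∫ s, kerE l (x - s) * q s) + (α * exp (l * x) + β * exp (-(l * x))) := by
    intro l k m hl h1 h2 h3
    refine exists_eq_integral_kerE hl (e := fun x => y 4 x - (k ^ 2 + m ^ 2) * y 2 x + k ^ 2 * m ^ 2 * y 0 x)
      (e' := fun x => y 5 x - (k ^ 2 + m ^ 2) * y 3 x + k ^ 2 * m ^ 2 * y 1 x) hq hQ
      (fun t => ?_) fun t => ?_
    · exact ((hy 4 (by omega) t).sub ((hy 2 (by omega) t).const_mul _)).add
        ((hy 0 (by omega) t).const_mul _)
    · refine (((hy 5 (by omega) t).sub ((hy 3 (by omega) t).const_mul _)).add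
        ((hy 1 (by omega) t).const_mul _)).congr_deriv ?_
      have := heq t
      rw [← h1, ← h2, ← h3] at this
      simp only [Nat.reduceAdd]
      linear_combination this
  obtain ⟨α1, β1, h1⟩ := main a b c ha rfl rfl rfl
  obtain ⟨α2, β2, h2⟩ := main b a c hb (by ring) (by ring) (by ring)
  obtain ⟨α3, β3, h3⟩ := main c a b hc (by ring) (by ring) (by ring)
  have n1 : b ^ 2 - a ^ 2 ≠ 0 := by nlinarith
  have n2 : c ^ 2 - a ^ 2 ≠ 0 := by nlinarith
  have n3 : c ^ 2 - b ^ 2 ≠ 0 := by nlinarith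
  have n1' : a ^ 2 - b ^ 2 ≠ 0 := by nlinarith
  have n2' : a ^ 2 - c ^ 2 ≠ 0 := by nlinarith
  have n3' : b ^ 2 - c ^ 2 ≠ 0 := by nlinarith
  have hG : ∀ x, ∫ s, kerG a b c (x - s) * q s =
      (∫ s, kerE a (x - s) * q s) / ((b ^ 2 - a ^ 2) * (c ^ 2 - a ^ 2)) +
      (∫ s, kerE b (x - s) * q s) / ((a ^ 2 - b ^ 2) * (c ^ 2 - b ^ 2)) +
      (∫ s, kerE c (x - s) * q s) / ((a ^ 2 - c ^ 2) * (b ^ 2 - c ^ 2)) := fun x => by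
    have i1 := integrable_kerE_sub_mul ha hq hQ x
    have i2 := integrable_kerE_sub_mul hb hq hQ x
    have i3 := integrable_kerE_sub_mul hc hq hQ x
    have e1 := integral_add (i1.div_const ((b ^ 2 - a ^ 2) * (c ^ 2 - a ^ 2)))
      (i2.div_const ((a ^ 2 - b ^ 2) * (c ^ 2 - b ^ 2)))
    have e2 := integral_add ((i1.div_const ((b ^ 2 - a ^ 2) * (c ^ 2 - a ^ 2))).add
      (i2.div_const ((a ^ 2 - b ^ 2) * (c ^ 2 - b ^ 2))))
      (i3.div_const ((a ^ 2 - c ^ 2) * (b ^ 2 - c ^ 2)))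
    simp only [Pi.add_apply] at e2
    rw [← integral_div, ← integral_div, ← integral_div, ← e1, ← e2]
    refine integral_congr_ae (ae_of_all _ fun s => ?_)
    simp only [kerG]; ring
  have key : ∀ x, y 0 x - ∫ s, kerG a b c (x - s) * q s =
      (α1 / ((b ^ 2 - a ^ 2) * (c ^ 2 - a ^ 2)) * exp (a * x) +
        β1 / ((b ^ 2 - a ^ 2) * (c ^ 2 - a ^ 2)) * exp (-(a * x))) +
      (α2 / ((a ^ 2 - b ^ 2) * (c ^ 2 - b ^ 2)) * exp (b * x) +
        β2 / ((a ^ 2 - b ^ 2) * (c ^ 2 - b ^ 2)) * exp (-(b * x))) +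
      (α3 / ((a ^ 2 - c ^ 2) * (b ^ 2 - c ^ 2)) * exp (c * x) +
        β3 / ((a ^ 2 - c ^ 2) * (b ^ 2 - c ^ 2)) * exp (-(c * x))) := fun x => by
    have e : y 0 x = (y 4 x - (b ^ 2 + c ^ 2) * y 2 x + b ^ 2 * c ^ 2 * y 0 x) /
          ((b ^ 2 - a ^ 2) * (c ^ 2 - a ^ 2)) +
        (y 4 x - (a ^ 2 + c ^ 2) * y 2 x + a ^ 2 * c ^ 2 * y 0 x) /
          ((a ^ 2 - b ^ 2) * (c ^ 2 - b ^ 2)) +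
        (y 4 x - (a ^ 2 + b ^ 2) * y 2 x + a ^ 2 * b ^ 2 * y 0 x) /
          ((a ^ 2 - c ^ 2) * (b ^ 2 - c ^ 2)) := by
      generalize y 0 x = u
      generalize y 2 x = v
      generalize y 4 x = w
      field_simp
      ring
    rw [hG, e, h1, h2, h3]
    ring
  have hbd : ∀ x, |y 0 x - ∫ s, kerG a b c (x - s) * q s| ≤ M + (∫ s, |kerG a b c s|) * Q :=
    fun x => (abs_sub _ _).trans
      (add_le_add (hM x) (abs_integral_kernel_mul_le (integrable_kerG ha hb hc) hQ x))
  obtain ⟨⟨z1, z2, z3⟩, z1', z2', z3'⟩ := eq_zero_of_bounded_exp_sum ha hab hbc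
    (fun x => by rw [← key x]; exact hbd x)
  have := key x
  rw [z1, z2, z3, z1', z2', z3'] at this
  linarith

theorem exists_exp_features : ∃ e : ℝ → ℝ → Lp ℝ 2 (volume : Measure ℝ), ∀ l m x y, 0 < l → 0 < m →
    y ≤ x → ⟪e l x, e m y⟫_ℝ = exp (-(l * (x - y))) / (l + m) := by
  have h : ∀ l x : ℝ, ∃ e : Lp ℝ 2 (volume : Measure ℝ),
      0 < l → e =ᵐ[volume] (Iic x).indicator fun s => exp (l * (s - x)) := by
    intro l x
    by_cases hl : 0 < l
    swap
    · exact ⟨0, fun h => absurd h hl⟩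
    have hmeas : AEStronglyMeasurable ((Iic x).indicator fun s => exp (l * (s - x))) volume :=
      (Continuous.aestronglyMeasurable (by fun_prop)).indicator measurableSet_Iic
    have hmem : MemLp ((Iic x).indicator fun s => exp (l * (s - x))) 2 volume := by
      rw [memLp_two_iff_integrable_sq hmeas]
      have h1 : IntegrableOn (fun s => exp (-(2 * l * x)) * exp (2 * l * s)) (Iic x) :=
        (integrableOn_exp_mul_Iic (by positivity) x).const_mul _
      refine (h1.integrable_indicator measurableSet_Iic).congr (ae_of_all _ fun s => ?_)
      by_cases hs : s ∈ Iic x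
      · simp only [indicator_of_mem hs]
        rw [← exp_add, sq, ← exp_add]; ring_nf
      · simp [indicator_of_notMem hs]
    exact ⟨hmem.toLp _, fun _ => hmem.coeFn_toLp⟩
  choose e he using h
  refine ⟨e, fun l m x y hl hm hxy => ?_⟩
  rw [L2.inner_def]
  have h1 : (fun s => ⟪e l x s, e m y s⟫_ℝ) =ᵐ[volume]
      (Iic y).indicator fun s => exp (-(l * x + m * y)) * exp ((l + m) * s) := by
    filter_upwards [he l x hl, he m y hm] with s h1 h2
    rw [h1, h2]
    by_cases hs : s ∈ Iic y
    · have hs' : s ∈ Iic x := le_trans hs hxy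
      simp only [indicator_of_mem hs, indicator_of_mem hs', RCLike.inner_apply, conj_trivial]
      rw [← exp_add, ← exp_add]; ring_nf
    · simp [indicator_of_notMem hs]
  rw [integral_congr_ae h1, integral_indicator measurableSet_Iic, integral_const_mul,
    integral_exp_mul_Iic (by positivity), ← mul_div_assoc, ← exp_add]
  ring_nf

theorem exists_kerG_features {a b c : ℝ} (ha : 0 < a) (hab : a < b) (hbc : b < c) :
    ∃ κ : ℝ → Lp ℝ 2 (volume : Measure ℝ), ∀ x y, ⟪κ x, κ y⟫_ℝ = kerG a b c (x - y) := by
  have hb : 0 < b := ha.trans hab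
  have hc : 0 < c := hb.trans hbc
  obtain ⟨e, he⟩ := exists_exp_features
  let α := 1 / ((b - a) * (c - a))
  let β := 1 / ((a - b) * (c - b))
  let γ := 1 / ((a - c) * (b - c))
  let κ : ℝ → Lp ℝ 2 (volume : Measure ℝ) := fun x => α • e a x + β • e b x + γ • e c x
  have key : ∀ x y, y ≤ x → ⟪κ x, κ y⟫_ℝ = kerG a b c (x - y) := by
    intro x y hxy
    simp only [κ, inner_add_left, inner_add_right, real_inner_smul_left, real_inner_smul_right,
      he _ _ x y ha ha hxy, he _ _ x y ha hb hxy, he _ _ x y ha hc hxy, he _ _ x y hb ha hxy,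
      he _ _ x y hb hb hxy, he _ _ x y hb hc hxy, he _ _ x y hc ha hxy, he _ _ x y hc hb hxy,
      he _ _ x y hc hc hxy]
    simp only [kerG, kerE, abs_of_nonneg (sub_nonneg.2 hxy)]
    have n1 : b - a ≠ 0 := by linarith
    have n2 : c - a ≠ 0 := by linarith
    have n3 : c - b ≠ 0 := by linarith
    have n1' : a - b ≠ 0 := by linarith
    have n2' : a - c ≠ 0 := by linarith
    have n3' : b - c ≠ 0 := by linarith
    have p1 : a + b ≠ 0 := by positivity
    have p2 : a + c ≠ 0 := by positivity
    have p3 : b + c ≠ 0 := by positivity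
    generalize exp (-(a * (x - y))) = u
    generalize exp (-(b * (x - y))) = v
    generalize exp (-(c * (x - y))) = w
    have hA : α * (α / (a + a) + β / (a + b) + γ / (a + c)) =
        1 / (2 * a) / ((b ^ 2 - a ^ 2) * (c ^ 2 - a ^ 2)) := by
      rw [show b ^ 2 - a ^ 2 = (b - a) * (a + b) by ring, show c ^ 2 - a ^ 2 = (c - a) * (a + c) by ring]
      simp only [α, β, γ]
      field_simp
      ring
    have hB : β * (α / (b + a) + β / (b + b) + γ / (b + c)) =
        1 / (2 * b) / ((a ^ 2 - b ^ 2) * (c ^ 2 - b ^ 2)) := by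
      rw [show a ^ 2 - b ^ 2 = (a - b) * (a + b) by ring, show c ^ 2 - b ^ 2 = (c - b) * (b + c) by ring, add_comm b a]
      simp only [α, β, γ]
      field_simp
      ring
    have hC : γ * (α / (c + a) + β / (c + b) + γ / (c + c)) =
        1 / (2 * c) / ((a ^ 2 - c ^ 2) * (b ^ 2 - c ^ 2)) := by
      rw [show a ^ 2 - c ^ 2 = (a - c) * (a + c) by ring, show b ^ 2 - c ^ 2 = (b - c) * (b + c) by ring, add_comm c a, add_comm c b]
      simp only [α, β, γ]
      field_simp
      ring
    linear_combination u * hA + v * hB + w * hC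
  refine ⟨κ, fun x y => ?_⟩
  rcases le_total y x with h | h
  · exact key x y h
  · rw [real_inner_comm, key y x h, ← kerG_neg, neg_sub]

section Gram

variable {H : Type*} [NormedAddCommGroup H] [InnerProductSpace ℝ H] {κ : ℝ → H} {a b c : ℝ}

theorem hasDerivAt_iteratedDeriv {N : ℕ} {v : ℝ → ℝ} (hv : ContDiff ℝ N v) {j : ℕ} (hj : j < N)
    (t : ℝ) : HasDerivAt (iteratedDeriv j v) (iteratedDeriv (j + 1) v t) t := by
  rw [iteratedDeriv_succ]
  exact ((hv.differentiable_iteratedDeriv j (by exact_mod_cast hj)) t).hasDerivAt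

theorem tsupport_iteratedDeriv_subset (v : ℝ → ℝ) (j : ℕ) :
    tsupport (iteratedDeriv j v) ⊆ tsupport v := by
  induction j with
  | zero => simp
  | succ j ih => rw [iteratedDeriv_succ]; exact tsupport_deriv_subset.trans ih

theorem abs_inner_le_of_gram (hκ : ∀ x y, ⟪κ x, κ y⟫_ℝ = kerG a b c (x - y)) (h : H) (x : ℝ) :
    |⟪h, κ x⟫_ℝ| ≤ ‖h‖ * √(kerG a b c 0) := by
  refine (abs_real_inner_le_norm _ _).trans (le_of_eq ?_)
  have : kerG a b c 0 = ‖κ x‖ ^ 2 := by rw [← real_inner_self_eq_norm_sq, hκ, sub_self]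
  rw [this, Real.sqrt_sq (norm_nonneg _)]

theorem norm_sub_sq_of_gram (hκ : ∀ x y, ⟪κ x, κ y⟫_ℝ = kerG a b c (x - y)) (x y : ℝ) :
    ‖κ x - κ y‖ ^ 2 = 2 * (kerG a b c 0 - kerG a b c (x - y)) := by
  rw [norm_sub_sq_real, ← real_inner_self_eq_norm_sq, ← real_inner_self_eq_norm_sq, hκ, hκ, hκ,
    sub_self, sub_self]
  ring

theorem continuous_of_gram (hκ : ∀ x y, ⟪κ x, κ y⟫_ℝ = kerG a b c (x - y)) : Continuous κ := by
  rw [continuous_iff_continuousAt]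
  intro y
  rw [ContinuousAt, tendsto_iff_norm_sub_tendsto_zero]
  have h1 : Tendsto (fun x => √(2 * (kerG a b c 0 - kerG a b c (x - y)))) (𝓝 y) (𝓝 0) := by
    have : Continuous fun x => √(2 * (kerG a b c 0 - kerG a b c (x - y))) := by
      have := continuous_kerG a b c
      fun_prop
    have h := this.tendsto y
    simpa using h
  refine h1.congr fun x => ?_
  rw [← norm_sub_sq_of_gram hκ, Real.sqrt_sq (norm_nonneg _)]

theorem abs_kerE_le {l : ℝ} (hl : 0 < l) (t : ℝ) : |kerE l t| ≤ 1 / (2 * l) := by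
  rw [kerE, abs_of_pos (by positivity)]
  gcongr
  exact exp_le_one_iff.2 (by have := mul_nonneg hl.le (abs_nonneg t); linarith)

theorem exists_norm_sub_le_of_gram (ha : 0 < a) (hab : a < b) (hbc : b < c)
    (hκ : ∀ x y, ⟪κ x, κ y⟫_ℝ = kerG a b c (x - y)) :
    ∃ C, 0 < C ∧ ∀ x, ‖κ x - κ 0‖ ≤ C * |x| := by
  have hb : 0 < b := ha.trans hab
  obtain ⟨F', hF, hF'⟩ := exists_hasDerivAt_kerG ha hab hbc
  have hG0 : 0 ≤ kerG a b c 0 := by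
    have h := hκ 0 0
    rw [sub_self] at h
    exact h ▸ real_inner_self_nonneg
  have hG : ∀ t, |kerG a b c t| ≤ kerG a b c 0 := fun t => by
    have h1 := abs_real_inner_le_norm (κ t) (κ 0)
    have h2 : ∀ x, ‖κ x‖ = √(kerG a b c 0) := fun x => by
      rw [← sub_self x, ← hκ, real_inner_self_eq_norm_sq, Real.sqrt_sq (norm_nonneg _)]
    rwa [hκ, sub_zero, h2, h2, Real.mul_self_sqrt hG0] at h1
  have h0 : F' 0 = 0 := by
    refine IsLocalMax.hasDerivAt_eq_zero (f := kerG a b c) (a := 0) ?_ (hF 0)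
    exact Eventually.of_forall fun t => (le_abs_self _).trans (hG t)
  have hFb : ∀ t, |kerF a b t| ≤ (1 / (2 * a) + 1 / (2 * b)) / (b ^ 2 - a ^ 2) := fun t => by
    have : 0 < b ^ 2 - a ^ 2 := by nlinarith
    rw [kerF, abs_div, abs_of_pos this]
    gcongr
    exact (abs_sub _ _).trans (add_le_add (abs_kerE_le ha t) (abs_kerE_le hb t))
  set C := c ^ 2 * kerG a b c 0 + (1 / (2 * a) + 1 / (2 * b)) / (b ^ 2 - a ^ 2) with hC
  have hC0 : 0 < C := by
    have : 0 < b ^ 2 - a ^ 2 := by nlinarith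
    positivity
  have hF'b : ∀ t, |F' t| ≤ C * |t| := fun t => by
    have := convex_univ.norm_image_sub_le_of_norm_hasDerivWithin_le (f := F')
      (f' := fun t => c ^ 2 * kerG a b c t - kerF a b t) (C := C) (x := 0) (y := t)
      (fun x _ => (hF' x).hasDerivWithinAt) (fun x _ => ?_) (mem_univ _) (mem_univ _)
    · simpa [h0] using this
    · refine (abs_sub _ _).trans (add_le_add ?_ (hFb x))
      rw [abs_mul, abs_of_nonneg (sq_nonneg c)]
      exact mul_le_mul_of_nonneg_left (hG x) (sq_nonneg c)
  have hGb : ∀ t, |kerG a b c t - kerG a b c 0| ≤ C * |t| * |t| := fun t => by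
    have := (convex_uIcc 0 t).norm_image_sub_le_of_norm_hasDerivWithin_le (f := kerG a b c)
      (f' := F') (C := C * |t|) (x := 0) (y := t)
      (fun x _ => (hF x).hasDerivWithinAt) (fun x hx => ?_) left_mem_uIcc right_mem_uIcc
    · simpa using this
    · refine (hF'b x).trans (mul_le_mul_of_nonneg_left ?_ hC0.le)
      have := abs_sub_left_of_mem_uIcc hx
      simpa using this
  refine ⟨√(2 * C), by positivity, fun x => ?_⟩
  refine abs_le_of_sq_le_sq' ?_ (by positivity) |>.2
  rw [norm_sub_sq_of_gram hκ, mul_pow, Real.sq_sqrt (by positivity), sub_zero, sq_abs]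
  have h1 := hGb x
  rw [mul_assoc, abs_mul_abs_self] at h1
  have h2 := neg_abs_le (kerG a b c x - kerG a b c 0)
  nlinarith

/-- `g` pairs with the features of the Green kernel as the test function `η` does. -/
theorem exists_test_vector [CompleteSpace H] (ha : 0 < a) (hab : a < b) (hbc : b < c)
    (hκ : ∀ x y, ⟪κ x, κ y⟫_ℝ = kerG a b c (x - y)) {η : ℝ → ℝ} (hη : ContDiff ℝ 6 η)
    (hs : HasCompactSupport η) : ∃ (q : ℝ → ℝ) (g : H), Continuous q ∧
      (∀ s, s ∉ tsupport η → q s = 0) ∧ (∀ h : H, ⟪h, g⟫_ℝ = ∫ s, q s * ⟪h, κ s⟫_ℝ) ∧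
      ∀ x, ⟪κ x, g⟫_ℝ = η x := by
  let q : ℝ → ℝ := fun t => -(iteratedDeriv 6 η t - (a ^ 2 + b ^ 2 + c ^ 2) * iteratedDeriv 4 η t +
    (a ^ 2 * b ^ 2 + a ^ 2 * c ^ 2 + b ^ 2 * c ^ 2) * iteratedDeriv 2 η t -
      a ^ 2 * b ^ 2 * c ^ 2 * iteratedDeriv 0 η t)
  have hη' : ContDiff ℝ (6 : ℕ) η := by exact_mod_cast hη
  have hcont : ∀ j ≤ 6, Continuous (iteratedDeriv j η) := fun j hj =>
    hη'.continuous_iteratedDeriv j (by exact_mod_cast hj)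
  have hq : Continuous q := by
    have h6 := hcont 6 (by omega)
    have h4 := hcont 4 (by omega)
    have h2 := hcont 2 (by omega)
    have h0 := hcont 0 (by omega)
    fun_prop
  have hq0 : ∀ s, s ∉ tsupport η → q s = 0 := fun s hs => by
    have : ∀ j, iteratedDeriv j η s = 0 := fun j =>
      image_eq_zero_of_notMem_tsupport fun h => hs (tsupport_iteratedDeriv_subset η j h)
    simp only [q, this]; ring
  have hqs : HasCompactSupport q := hs.mono' fun s h => by
    by_contra h'
    exact h (hq0 s h')
  have hκc := continuous_of_gram hκ
  have hint : Integrable fun s => q s • κ s :=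
    (hq.smul hκc).integrable_of_hasCompactSupport hqs.smul_right
  have hinner : ∀ h : H, ⟪h, ∫ s, q s • κ s⟫_ℝ = ∫ s, q s * ⟪h, κ s⟫_ℝ := fun h => by
    rw [← integral_inner hint]
    simp only [real_inner_smul_right]
  obtain ⟨M, hM⟩ := hs.exists_bound_of_continuous hη.continuous
  obtain ⟨Q, hQ⟩ := hqs.exists_bound_of_continuous hq
  refine ⟨q, ∫ s, q s • κ s, hq, hq0, hinner, fun x => ?_⟩
  have := eq_integral_kerG ha hab hbc (y := fun j => iteratedDeriv j η) hq hQ (M := M)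
    (by simpa using hM) (fun j hj t => hasDerivAt_iteratedDeriv hη' hj t)
    (fun t => by simp only [q, neg_neg]) x
  simp only [iteratedDeriv_zero] at this
  rw [hinner, this]
  exact integral_congr_ae (ae_of_all _ fun s => by simp only [hκ, mul_comm])

theorem exists_inner_eq_on_finset [CompleteSpace H] (ha : 0 < a) (hab : a < b) (hbc : b < c)
    (hκ : ∀ x y, ⟪κ x, κ y⟫_ℝ = kerG a b c (x - y)) (Z : Finset ℝ) (y : ℝ → ℝ) :
    ∃ h ∈ Submodule.span ℝ (κ '' Z), ∀ z ∈ Z, ⟪h, κ z⟫_ℝ = y z := by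
  obtain ⟨R, hR⟩ := Z.finite_toSet.isBounded.subset_closedBall (0 : ℝ)
  let f : ContDiffBump (0 : ℝ) := ⟨max R 1, max R 1 + 1, by positivity, by linarith⟩
  let p := Lagrange.interpolate Z id y
  obtain ⟨q, g, -, -, -, hg⟩ := exists_test_vector ha hab hbc hκ (η := fun x => f x * p.eval x)
    (f.contDiff.mul (by simpa using p.contDiff_aeval (𝕜 := ℝ) 6)) f.hasCompactSupport.mul_right
  have : FiniteDimensional ℝ (Submodule.span ℝ (κ '' (Z : Set ℝ))) :=
    FiniteDimensional.span_of_finite ℝ (Z.finite_toSet.image κ)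
  refine ⟨(Submodule.span ℝ (κ '' (Z : Set ℝ))).starProjection g, Submodule.starProjection_apply_mem _ _,
    fun z hz => ?_⟩
  have h1 := Submodule.starProjection_inner_eq_zero (K := Submodule.span ℝ (κ '' (Z : Set ℝ))) g (κ z)
    (Submodule.subset_span ⟨z, hz, rfl⟩)
  rw [inner_sub_left, sub_eq_zero] at h1
  rw [← h1, real_inner_comm, hg]
  have h2 : f z = 1 := f.one_of_mem_closedBall
    (Metric.closedBall_subset_closedBall (le_max_left _ _) (hR hz))
  have h3 : p.eval z = y z := Lagrange.eval_interpolate_at_node (v := id) y (injOn_id _) hz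
  simp only [h2, h3, one_mul]

theorem exists_inner_eq_sum_of_mem_span (hκ : ∀ x y, ⟪κ x, κ y⟫_ℝ = kerG a b c (x - y))
    {X : Finset ℝ} {h : H} (hh : h ∈ Submodule.span ℝ (κ '' X)) :
    ∃ k : ℝ → ℝ, h = ∑ x ∈ X, k x • κ x ∧
      ∀ t, ⟪h, κ t⟫_ℝ = ∑ x ∈ X, k x * kerG a b c (t - x) := by
  obtain ⟨k, rfl⟩ := (Submodule.mem_span_image_finset_iff_exists_fun' ℝ).1 hh
  refine ⟨k, rfl, fun t => ?_⟩
  rw [sum_inner]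
  refine Finset.sum_congr rfl fun x _ => ?_
  rw [real_inner_smul_left, hκ, ← kerG_neg, neg_sub]

theorem exists_enum (P : Finset ℝ) : ∃ s : ℕ → ℝ, (∀ i, i + 1 < P.card → s i < s (i + 1)) ∧
    ∀ i < P.card, s i ∈ P ∧ (P.filter (· < s i)).card = i := by
  classical
  induction P using Finset.induction_on_max with
  | empty => exact ⟨fun _ => 0, by simp⟩
  | insert m P hm ih =>
    obtain ⟨s, hs1, hs2⟩ := ih
    have hmP : m ∉ P := fun h => lt_irrefl _ (hm m h)
    refine ⟨fun i => if i < P.card then s i else m, fun i hi => ?_, fun i hi => ?_⟩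
    · rw [Finset.card_insert_of_notMem hmP] at hi
      have h1 : i < P.card := by omega
      simp only [h1, if_true]
      split_ifs with h2
      · exact hs1 i h2
      · exact hm _ (hs2 i h1).1
    · rw [Finset.card_insert_of_notMem hmP] at hi
      by_cases h1 : i < P.card
      · simp only [h1, if_true]
        refine ⟨Finset.mem_insert_of_mem (hs2 i h1).1, ?_⟩
        rw [Finset.filter_insert, if_neg (hm _ (hs2 i h1).1).le.not_gt, (hs2 i h1).2]
      · simp only [h1, if_false]
        refine ⟨Finset.mem_insert_self _ _, ?_⟩
        rw [Finset.filter_insert, if_neg (lt_irrefl _), Finset.filter_true_of_mem hm]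
        omega

/-- `(-1)` to the number of elements of `Z` below `s`. -/
def parity (Z : Finset ℝ) (s : ℝ) : ℝ := (-1) ^ (Z.filter (· < s)).card

theorem parity_sq (Z : Finset ℝ) (s : ℝ) : parity Z s * parity Z s = 1 := by
  rw [parity, ← pow_add, ← two_mul, pow_mul]; simp

theorem card_lt_of_parity_pos (ha : 0 < a) (hab : a < b) (hbc : b < c)
    (hκ : ∀ x y, ⟪κ x, κ y⟫_ℝ = kerG a b c (x - y)) {X P : Finset ℝ} {h : H}
    (hh : h ∈ Submodule.span ℝ (κ '' X)) (hP : ∀ p ∈ P, 0 < parity P p * ⟪h, κ p⟫_ℝ) :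
    P.card ≤ X.card := by
  obtain ⟨s, hs1, hs2⟩ := exists_enum P
  obtain ⟨k, -, hk⟩ := exists_inner_eq_sum_of_mem_span hκ hh
  rcases Nat.eq_zero_or_pos P.card with h0 | h0
  · omega
  have : Alternates (P.card - 1) s fun t => ∑ x ∈ X, k x * kerG a b c (t - x) := by
    refine ⟨fun i hi => hs1 i (by omega), fun i hi => ?_⟩
    obtain ⟨h1, h2⟩ := hs2 i (by omega)
    have := hP _ h1
    rwa [parity, h2, hk] at this
  have := this.lt_card ha hab hbc
  omega

theorem parity_insert_insert {Z : Finset ℝ} {s t : ℝ} (hs : s ∉ Z) (hst : s < t) :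
    parity (insert s (insert t Z)) s = parity Z s ∧
      parity (insert s (insert t Z)) t = -parity Z t := by
  classical
  constructor
  · rw [parity, Finset.filter_insert, if_neg (lt_irrefl _), Finset.filter_insert,
      if_neg hst.le.not_gt, parity]
  · rw [parity, Finset.filter_insert, if_pos hst, Finset.filter_insert, if_neg (lt_irrefl _), parity,
      Finset.card_insert_of_notMem (by simp [hs]), pow_succ]
    ring

theorem sign_inner_of_lt [CompleteSpace H] (ha : 0 < a) (hab : a < b) (hbc : b < c)
    (hκ : ∀ x y, ⟪κ x, κ y⟫_ℝ = kerG a b c (x - y)) {Z : Finset ℝ} {x : ℝ} {h : H}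
    (hh : h ∈ Submodule.span ℝ (κ '' (insert x Z : Finset ℝ))) (hZ : ∀ z ∈ Z, ⟪h, κ z⟫_ℝ = 0)
    {s t : ℝ} (hst : s < t) (hs : s ∉ Z) (ht : t ∉ Z)
    (h1 : 0 < parity Z s * ⟪h, κ s⟫_ℝ) (h2 : 0 < -parity Z t * ⟪h, κ t⟫_ℝ) : False := by
  classical
  set P := insert s (insert t Z) with hP
  obtain ⟨hps, hpt⟩ := parity_insert_insert hs hst
  rw [← hP] at hps hpt
  obtain ⟨g, hg, hgz⟩ := exists_inner_eq_on_finset ha hab hbc hκ Z (parity P)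
  have hmem : ∀ ε : ℝ, h + ε • g ∈ Submodule.span ℝ (κ '' (insert x Z : Finset ℝ)) := fun ε =>
    Submodule.add_mem _ hh (Submodule.smul_mem _ _
      (Submodule.span_mono (image_mono (by simp)) hg))
  have hlim : ∀ u v : ℝ, 0 < u → ∀ᶠ ε : ℝ in 𝓝[>] 0, 0 < u + ε * v := fun u v hu => by
    have : Tendsto (fun ε : ℝ => u + ε * v) (𝓝 0) (𝓝 (u + 0 * v)) :=
      Continuous.tendsto (by fun_prop) 0
    exact (this.mono_left nhdsWithin_le_nhds).eventually (lt_mem_nhds (by simpa using hu))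
  obtain ⟨ε, ⟨hε1, hε2⟩, hε⟩ := (((hlim _ (parity Z s * ⟪g, κ s⟫_ℝ) h1).and
    (hlim _ (-parity Z t * ⟪g, κ t⟫_ℝ) h2)).and self_mem_nhdsWithin).exists
  have := card_lt_of_parity_pos (P := P) ha hab hbc hκ (hmem ε) fun p hp => by
    rw [inner_add_left, real_inner_smul_left]
    rcases Finset.mem_insert.1 hp with rfl | hp
    · rw [hps]; linarith
    rcases Finset.mem_insert.1 hp with rfl | hp
    · rw [hpt]; linarith
    · rw [hZ p hp, hgz p hp, zero_add, mul_left_comm, parity_sq, mul_one]; exact hε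
  have h3 : P.card = Z.card + 2 := by
    rw [hP, Finset.card_insert_of_notMem (by simp [hs, hst.ne]), Finset.card_insert_of_notMem ht]
  have h4 := Finset.card_insert_le x Z
  omega

/-- A combination of `κ x` and of the features at `Z` which vanishes at `Z` changes sign exactly
at `Z`. -/
theorem sign_inner [CompleteSpace H] (ha : 0 < a) (hab : a < b) (hbc : b < c)
    (hκ : ∀ x y, ⟪κ x, κ y⟫_ℝ = kerG a b c (x - y)) {Z : Finset ℝ} {x : ℝ} {h : H}
    (hh : h ∈ Submodule.span ℝ (κ '' (insert x Z : Finset ℝ))) (hZ : ∀ z ∈ Z, ⟪h, κ z⟫_ℝ = 0)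
    (s t : ℝ) : 0 ≤ (parity Z s * ⟪h, κ s⟫_ℝ) * (parity Z t * ⟪h, κ t⟫_ℝ) := by
  wlog hst : s < t generalizing s t
  · rcases (not_lt.1 hst).eq_or_lt with rfl | h1
    · exact mul_self_nonneg _
    · rw [mul_comm]; exact this t s h1
  by_cases hs : s ∈ Z
  · simp [hZ s hs]
  by_cases ht : t ∈ Z
  · simp [hZ t ht]
  by_contra! hneg
  rcases mul_neg_iff.1 hneg with ⟨h1, h2⟩ | ⟨h1, h2⟩
  · exact sign_inner_of_lt ha hab hbc hκ hh hZ hst hs ht h1 (by linarith)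
  · exact sign_inner_of_lt ha hab hbc hκ (h := -h) (Submodule.neg_mem _ hh)
      (fun z hz => by rw [inner_neg_left, hZ z hz, neg_zero]) hst hs ht
      (by rw [inner_neg_left]; linarith) (by rw [inner_neg_left]; linarith)

end Gram

theorem abs_coeff_le {p q r u v w δ : ℝ} (hpq : p ≠ q) (hpr : p ≠ r) (hq : |q| ≤ 1) (hr : |r| ≤ 1)
    (h0 : |u + v + w| ≤ δ) (h1 : |u * p + v * q + w * r| ≤ δ)
    (h2 : |u * p ^ 2 + v * q ^ 2 + w * r ^ 2| ≤ δ) : |u| ≤ 4 / |(p - q) * (p - r)| * δ := by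
  have hne : (p - q) * (p - r) ≠ 0 := mul_ne_zero (sub_ne_zero.2 hpq) (sub_ne_zero.2 hpr)
  have h3 : u * ((p - q) * (p - r)) = (u * p ^ 2 + v * q ^ 2 + w * r ^ 2) -
      (q + r) * (u * p + v * q + w * r) + q * r * (u + v + w) := by ring
  have h4 : |u * ((p - q) * (p - r))| ≤ 4 * δ := by
    rw [h3]
    have hδ : 0 ≤ δ := (abs_nonneg _).trans h0
    have e1 : |(q + r) * (u * p + v * q + w * r)| ≤ 2 * δ := by
      rw [abs_mul]
      exact mul_le_mul ((abs_add_le _ _).trans (by linarith)) h1 (abs_nonneg _) (by norm_num)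
    have e2 : |q * r * (u + v + w)| ≤ 1 * δ := by
      rw [abs_mul, abs_mul]
      exact mul_le_mul (mul_le_one₀ hq (abs_nonneg _) hr) h0 (abs_nonneg _) (by norm_num)
    refine (abs_add_le _ _).trans ?_
    have := abs_sub (u * p ^ 2 + v * q ^ 2 + w * r ^ 2) ((q + r) * (u * p + v * q + w * r))
    linarith
  rw [abs_mul] at h4
  rw [div_mul_eq_mul_div, le_div_iff₀ (abs_pos.2 hne)]
  exact h4

theorem exists_integral_abs_exp_sum_le {a b c : ℝ} (ha : 0 < a) (hab : a < b) (hbc : b < c) :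
    ∃ C, 0 ≤ C ∧ ∀ (u v w δ : ℝ),
      (∀ r, 0 ≤ r → |u * exp (-a * r) + v * exp (-b * r) + w * exp (-c * r)| ≤ δ) →
      ∫ r in Ioi 0, |u * exp (-a * r) + v * exp (-b * r) + w * exp (-c * r)| ≤ C * δ := by
  have hb : 0 < b := ha.trans hab
  have hc : 0 < c := hb.trans hbc
  set p := exp (-a)
  set q := exp (-b)
  set r := exp (-c)
  have hpq : p ≠ q := fun h => by have := exp_injective h; linarith
  have hpr : p ≠ r := fun h => by have := exp_injective h; linarith
  have hqr : q ≠ r := fun h => by have := exp_injective h; linarith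
  have hle : ∀ l, 0 < l → |exp (-l)| ≤ 1 := fun l hl => by
    rw [abs_of_pos (exp_pos _)]; exact exp_le_one_iff.2 (by linarith)
  have hi : ∀ l, 0 < l → IntegrableOn (fun s => exp (-l * s)) (Ioi 0) := fun l hl =>
    integrableOn_exp_mul_Ioi (neg_lt_zero.2 hl) 0
  have hv : ∀ l, 0 < l → ∫ s in Ioi (0 : ℝ), exp (-l * s) = 1 / l := fun l hl => by
    rw [integral_exp_mul_Ioi (neg_lt_zero.2 hl)]; simp [neg_div_neg_eq]
  refine ⟨4 / |(p - q) * (p - r)| * (1 / a) + 4 / |(q - p) * (q - r)| * (1 / b) +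
    4 / |(r - p) * (r - q)| * (1 / c), by positivity, fun u v w δ h => ?_⟩
  have h0 := h 0 le_rfl
  have h1 := h 1 zero_le_one
  have h2 := h 2 zero_le_two
  have hsq : ∀ l, exp (-l * 2) = exp (-l) ^ 2 := fun l => by rw [← exp_nat_mul]; ring_nf
  simp only [mul_zero, exp_zero, mul_one, hsq] at h0 h1 h2
  have hu := abs_coeff_le hpq hpr (hle b hb) (hle c hc) h0 h1 h2
  have hv' := abs_coeff_le (u := v) (v := u) (w := w) (δ := δ) hpq.symm hqr (hle a ha) (hle c hc)
    (by rwa [add_comm v u]) (by rwa [add_comm (v * q)]) (by rwa [add_comm (v * q ^ 2)])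
  have hw := abs_coeff_le (u := w) (v := u) (w := v) (δ := δ) hpr.symm hqr.symm (hle a ha) (hle b hb)
    (by rwa [add_assoc, add_comm w]) (by rwa [add_assoc, add_comm (w * r)])
    (by rwa [add_assoc, add_comm (w * r ^ 2)])
  have hint : IntegrableOn (fun s => |u| * exp (-a * s) + |v| * exp (-b * s) + |w| * exp (-c * s))
      (Ioi 0) := (((hi a ha).const_mul _).add ((hi b hb).const_mul _)).add ((hi c hc).const_mul _)
  calc ∫ s in Ioi 0, |u * exp (-a * s) + v * exp (-b * s) + w * exp (-c * s)|
      ≤ ∫ s in Ioi 0, (|u| * exp (-a * s) + |v| * exp (-b * s) + |w| * exp (-c * s)) := by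
        refine integral_mono_of_nonneg (ae_of_all _ fun s => abs_nonneg _) hint
          (ae_of_all _ fun s => ?_)
        refine (abs_add_three _ _ _).trans (le_of_eq ?_)
        simp only [abs_mul, abs_of_pos (exp_pos _)]
    _ = |u| * (1 / a) + |v| * (1 / b) + |w| * (1 / c) := by
        rw [← hv a ha, ← hv b hb, ← hv c hc, ← integral_const_mul, ← integral_const_mul,
          ← integral_const_mul, ← integral_add ((hi a ha).const_mul _) ((hi b hb).const_mul _)]
        exact integral_add (((hi a ha).const_mul _).add ((hi b hb).const_mul _))
          ((hi c hc).const_mul _)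
    _ ≤ _ := by
        have e1 := mul_le_mul_of_nonneg_right hu (by positivity : 0 ≤ 1 / a)
        have e2 := mul_le_mul_of_nonneg_right hv' (by positivity : 0 ≤ 1 / b)
        have e3 := mul_le_mul_of_nonneg_right hw (by positivity : 0 ≤ 1 / c)
        linarith

theorem exists_integral_Ioi_abs_sum_kerG_le {a b c : ℝ} (ha : 0 < a) (hab : a < b) (hbc : b < c) :
    ∃ C, 0 ≤ C ∧ ∀ (X : Finset ℝ) (k y : ℝ → ℝ) (R δ : ℝ), (∀ x ∈ X, y x ≤ R) →
      (∀ s, R ≤ s → |∑ x ∈ X, k x * kerG a b c (s - y x)| ≤ δ) →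
      ∫ s in Ioi R, |∑ x ∈ X, k x * kerG a b c (s - y x)| ≤ C * δ := by
  obtain ⟨C, hC, h⟩ := exists_integral_abs_exp_sum_le ha hab hbc
  refine ⟨C, hC, fun X k y R δ hX hδ => ?_⟩
  have key : ∀ r, 0 ≤ r → ∑ x ∈ X, k x * kerG a b c (R + r - y x) =
      (∑ x ∈ X, k x * (exp (-(a * (R - y x))) / (2 * a) / ((b ^ 2 - a ^ 2) * (c ^ 2 - a ^ 2)))) *
        exp (-a * r) +
      (∑ x ∈ X, k x * (exp (-(b * (R - y x))) / (2 * b) / ((a ^ 2 - b ^ 2) * (c ^ 2 - b ^ 2)))) *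
        exp (-b * r) +
      (∑ x ∈ X, k x * (exp (-(c * (R - y x))) / (2 * c) / ((a ^ 2 - c ^ 2) * (b ^ 2 - c ^ 2)))) *
        exp (-c * r) := fun r hr => by
    rw [Finset.sum_mul, Finset.sum_mul, Finset.sum_mul, ← Finset.sum_add_distrib,
      ← Finset.sum_add_distrib]
    refine Finset.sum_congr rfl fun x hx => ?_
    have e : ∀ l : ℝ, exp (-(l * (R + r - y x))) = exp (-(l * (R - y x))) * exp (-l * r) := fun l => by
      rw [← exp_add]; ring_nf
    simp only [kerG, kerE, abs_of_nonneg (show 0 ≤ R + r - y x by linarith [hX x hx]), e]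
    ring
  have h1 := h _ _ _ δ fun r hr => by rw [← key r hr]; exact hδ _ (by linarith)
  refine le_trans (le_of_eq ?_) h1
  have h2 := (measurePreserving_add_left volume R).setIntegral_preimage_emb
    (measurableEmbedding_addLeft R) (fun s => |∑ x ∈ X, k x * kerG a b c (s - y x)|) (Ioi R)
  rw [preimage_const_add_Ioi, sub_self] at h2
  rw [← h2]
  exact setIntegral_congr_fun measurableSet_Ioi fun r hr => by rw [key r (le_of_lt hr)]

theorem integrable_sum_kerG {a b c : ℝ} (ha : 0 < a) (hb : 0 < b) (hc : 0 < c) (X : Finset ℝ)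
    (k : ℝ → ℝ) : Integrable fun s => ∑ x ∈ X, k x * kerG a b c (s - x) :=
  integrable_finsetSum _ fun x _ => ((integrable_kerG ha hb hc).comp_sub_right x).const_mul _

theorem exists_integral_abs_sum_kerG_le {a b c : ℝ} (ha : 0 < a) (hab : a < b) (hbc : b < c) :
    ∃ C, 0 ≤ C ∧ ∀ (X : Finset ℝ) (k : ℝ → ℝ) (R δ : ℝ), (∀ x ∈ X, |x| ≤ R) → 0 ≤ R →
      (∀ s, R ≤ |s| → |∑ x ∈ X, k x * kerG a b c (s - x)| ≤ δ) →
      ∫ s in (Icc (-R) R)ᶜ, |∑ x ∈ X, k x * kerG a b c (s - x)| ≤ C * δ := by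
  have hb : 0 < b := ha.trans hab
  have hc : 0 < c := hb.trans hbc
  obtain ⟨C, hC, h⟩ := exists_integral_Ioi_abs_sum_kerG_le ha hab hbc
  refine ⟨C + C, by positivity, fun X k R δ hX hR hδ => ?_⟩
  have hint := (integrable_sum_kerG ha hb hc X k).abs
  have hset : (Icc (-R) R)ᶜ = Iio (-R) ∪ Ioi R := by
    ext s; simp only [mem_compl_iff, mem_Icc, mem_union, mem_Iio, mem_Ioi, not_and_or, not_le]
  have hdisj : Disjoint (Iio (-R)) (Ioi R) := by
    rw [Set.disjoint_left]; intro s h1 h2; simp only [mem_Iio, mem_Ioi] at h1 h2; linarith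
  rw [hset, setIntegral_union hdisj measurableSet_Ioi hint.integrableOn hint.integrableOn, add_mul]
  refine add_le_add ?_ (h X k id R δ (fun x hx => (le_abs_self x).trans (hX x hx))
    fun s hs => hδ s (hs.trans (le_abs_self s)))
  rw [← integral_Iic_eq_integral_Iio, ← integral_comp_neg_Ioi]
  have e : ∀ s, ∑ x ∈ X, k x * kerG a b c (-s - x) = ∑ x ∈ X, k x * kerG a b c (s - -x) := fun s => by
    refine Finset.sum_congr rfl fun x _ => ?_
    rw [← kerG_neg]; ring_nf
  have := h X k (fun x => -x) R δ (fun x hx => (neg_le_abs x).trans (hX x hx)) fun s hs => by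
    rw [← e]; exact hδ _ (by rw [abs_neg]; exact hs.trans (le_abs_self s))
  simpa only [e] using this

theorem abs_setIntegral_eq {S : Set ℝ} (hS : MeasurableSet S) {Φ : ℝ → ℝ}
    (h : ∀ s ∈ S, ∀ t ∈ S, 0 ≤ Φ s * Φ t) : ∫ s in S, |Φ s| = |∫ s in S, Φ s| := by
  by_cases hp : ∀ s ∈ S, 0 ≤ Φ s
  · rw [abs_of_nonneg (setIntegral_nonneg hS hp)]
    exact setIntegral_congr_fun hS fun s hs => abs_of_nonneg (hp s hs)
  · push Not at hp
    obtain ⟨t, ht, ht'⟩ := hp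
    have hn : ∀ s ∈ S, Φ s ≤ 0 := fun s hs => by
      by_contra! h'
      have := h s hs t ht
      nlinarith
    rw [abs_of_nonpos (setIntegral_nonpos hS hn), ← integral_neg]
    exact setIntegral_congr_fun hS fun s hs => abs_of_nonpos (hn s hs)

/-- The residual of `κ x` after projection on the span of the features at `Z`. -/
def residual {H : Type*} [NormedAddCommGroup H] [InnerProductSpace ℝ H] (κ : ℝ → H) (Z : Finset ℝ)
    (x : ℝ) : H :=
  haveI : FiniteDimensional ℝ (Submodule.span ℝ (κ '' (Z : Set ℝ))) :=
    FiniteDimensional.span_of_finite ℝ (Z.finite_toSet.image κ)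
  κ x - (Submodule.span ℝ (κ '' (Z : Set ℝ))).starProjection (κ x)

section Gram

variable {H : Type*} [NormedAddCommGroup H] [InnerProductSpace ℝ H] {κ : ℝ → H} {a b c : ℝ}

theorem exists_residual_eq (κ : ℝ → H) (Z : Finset ℝ) (x : ℝ) :
    ∃ p ∈ Submodule.span ℝ (κ '' (Z : Set ℝ)), residual κ Z x = κ x - p := by
  have : FiniteDimensional ℝ (Submodule.span ℝ (κ '' (Z : Set ℝ))) :=
    FiniteDimensional.span_of_finite ℝ (Z.finite_toSet.image κ)
  exact ⟨_, Submodule.starProjection_apply_mem _ _, rfl⟩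

theorem residual_mem_span (κ : ℝ → H) (Z : Finset ℝ) (x : ℝ) :
    residual κ Z x ∈ Submodule.span ℝ (κ '' (insert x Z : Finset ℝ)) := by
  obtain ⟨p, hp, h⟩ := exists_residual_eq κ Z x
  rw [h]
  exact Submodule.sub_mem _ (Submodule.subset_span ⟨x, by simp, rfl⟩)
    (Submodule.span_mono (image_mono (by simp)) hp)

theorem inner_residual_eq_zero (κ : ℝ → H) {Z : Finset ℝ} (x : ℝ) {z : ℝ} (hz : z ∈ Z) :
    ⟪residual κ Z x, κ z⟫_ℝ = 0 := by
  have : FiniteDimensional ℝ (Submodule.span ℝ (κ '' (Z : Set ℝ))) :=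
    FiniteDimensional.span_of_finite ℝ (Z.finite_toSet.image κ)
  exact Submodule.starProjection_inner_eq_zero _ _ (Submodule.subset_span ⟨z, hz, rfl⟩)

theorem norm_residual_le (κ : ℝ → H) (Z : Finset ℝ) (x : ℝ) {p : H}
    (hp : p ∈ Submodule.span ℝ (κ '' (Z : Set ℝ))) : ‖residual κ Z x‖ ≤ ‖κ x - p‖ := by
  have : FiniteDimensional ℝ (Submodule.span ℝ (κ '' (Z : Set ℝ))) :=
    FiniteDimensional.span_of_finite ℝ (Z.finite_toSet.image κ)
  have h := Submodule.starProjection_minimal (U := Submodule.span ℝ (κ '' (Z : Set ℝ))) (κ x)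
  refine (le_of_eq h).trans ?_
  exact ciInf_le ⟨0, by rintro _ ⟨y, rfl⟩; exact norm_nonneg _⟩
    (⟨p, hp⟩ : Submodule.span ℝ (κ '' (Z : Set ℝ)))

theorem inner_residual_eq (κ : ℝ → H) {Z : Finset ℝ} (x : ℝ) {g : H}
    (hg : ∀ z ∈ Z, ⟪κ z, g⟫_ℝ = 0) : ⟪residual κ Z x, g⟫_ℝ = ⟪κ x, g⟫_ℝ := by
  obtain ⟨p, hp, h⟩ := exists_residual_eq κ Z x
  have : ⟪p, g⟫_ℝ = 0 := by
    obtain ⟨k, rfl⟩ := (Submodule.mem_span_image_finset_iff_exists_fun' ℝ).1 hp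
    rw [sum_inner]
    exact Finset.sum_eq_zero fun z hz => by rw [real_inner_smul_left, hg z hz, mul_zero]
  rw [h, inner_sub_left, this, sub_zero]

theorem exists_tendsto_residual [CompleteSpace H] (κ : ℝ → H) {Z : ℕ → Finset ℝ} (hZ : Monotone Z)
    (x : ℝ) : ∃ h, Tendsto (fun N => residual κ (Z N) x) atTop (𝓝 h) := by
  have : ∀ N, FiniteDimensional ℝ (Submodule.span ℝ (κ '' (Z N : Set ℝ))) := fun N =>
    FiniteDimensional.span_of_finite ℝ ((Z N).finite_toSet.image κ)
  have hm : Monotone fun N => Submodule.span ℝ (κ '' (Z N : Set ℝ)) := fun m n hmn =>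
    Submodule.span_mono (image_mono (by exact_mod_cast hZ hmn))
  exact ⟨_, (Submodule.starProjection_tendsto_closure_iSup _ hm (κ x)).const_sub (κ x)⟩

theorem tendsto_integral_residual_compl [CompleteSpace H] (ha : 0 < a) (hab : a < b) (hbc : b < c)
    (hκ : ∀ x y, ⟪κ x, κ y⟫_ℝ = kerG a b c (x - y)) {Z : ℕ → Finset ℝ} (hZ : Monotone Z)
    (hZN : ∀ N, ∀ z ∈ Z N, |z| ≤ N) (x : ℝ) :
    Tendsto (fun N : ℕ => ∫ s in (Icc (-(N : ℝ)) N)ᶜ, |⟪residual κ (Z N) x, κ s⟫_ℝ|) atTop (𝓝 0) := by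
  have hb : 0 < b := ha.trans hab
  have hc : 0 < c := hb.trans hbc
  obtain ⟨C, hC, hC'⟩ := exists_integral_abs_sum_kerG_le ha hab hbc
  obtain ⟨g, hg⟩ := exists_tendsto_residual κ hZ x
  have hsmall : ∀ δ > 0, ∀ᶠ N : ℕ in atTop, ∀ s, (N : ℝ) ≤ |s| →
      |⟪residual κ (Z N) x, κ s⟫_ℝ| ≤ δ := by
    intro δ hδ
    set G := √(kerG a b c 0) with hG
    have hG0 : 0 ≤ G := Real.sqrt_nonneg _
    have hpos : 0 < δ / (4 * (G + 1)) := by positivity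
    obtain ⟨N0, hN0⟩ := Metric.tendsto_atTop.1 hg _ hpos
    obtain ⟨k, -, hk⟩ := exists_inner_eq_sum_of_mem_span hκ (residual_mem_span κ (Z N0) x)
    have h1 : Tendsto (fun s => ⟪residual κ (Z N0) x, κ s⟫_ℝ) (cocompact ℝ) (𝓝 0) := by
      simp only [hk]
      exact tendsto_sum_translates (tendsto_kerG ha hb hc)
    have h2 := h1.eventually (Metric.ball_mem_nhds 0 (half_pos hδ))
    rw [← Metric.cobounded_eq_cocompact, ← comap_norm_atTop, Filter.eventually_comap] at h2
    obtain ⟨S, hS⟩ := eventually_atTop.1 h2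
    obtain ⟨N1, hN1⟩ := exists_nat_ge S
    filter_upwards [eventually_ge_atTop N0, eventually_ge_atTop N1] with N hN hN' s hs
    have h3 := hS |s| (hN1.trans ((Nat.cast_le.2 hN').trans hs)) s rfl
    rw [dist_zero_right, Real.norm_eq_abs] at h3
    have h4 : ‖residual κ (Z N) x - residual κ (Z N0) x‖ ≤ δ / (2 * (G + 1)) := by
      have e1 := hN0 N hN
      have e2 := hN0 N0 le_rfl
      rw [dist_eq_norm] at e1 e2
      have e3 := norm_sub_le_norm_sub_add_norm_sub (residual κ (Z N) x) g (residual κ (Z N0) x)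
      rw [norm_sub_rev g] at e3
      have e4 : δ / (2 * (G + 1)) = δ / (4 * (G + 1)) + δ / (4 * (G + 1)) := by field_simp; norm_num
      linarith
    have h5 := abs_inner_le_of_gram hκ (residual κ (Z N) x - residual κ (Z N0) x) s
    rw [inner_sub_left] at h5
    have h6 : ‖residual κ (Z N) x - residual κ (Z N0) x‖ * G ≤ δ / 2 := by
      refine (mul_le_mul_of_nonneg_right h4 hG0).trans ?_
      rw [div_mul_eq_mul_div, div_le_div_iff₀ (by positivity) (by norm_num)]
      nlinarith
    have h7 := abs_sub_abs_le_abs_sub ⟪residual κ (Z N) x, κ s⟫_ℝ ⟪residual κ (Z N0) x, κ s⟫_ℝ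
    linarith
  rw [Metric.tendsto_atTop']
  intro ε hε
  have h1 := hsmall (ε / (2 * (C + 1))) (by positivity)
  obtain ⟨N1, hN1⟩ := exists_nat_ge |x|
  obtain ⟨N2, hN2⟩ := eventually_atTop.1 h1
  refine ⟨max N1 N2, fun N hN => ?_⟩
  have hNN1 : (N1 : ℝ) ≤ N := by exact_mod_cast ((le_max_left _ _).trans hN.le)
  have h3 := hN2 N ((le_max_right _ _).trans hN.le)
  obtain ⟨k, -, hk⟩ := exists_inner_eq_sum_of_mem_span hκ (residual_mem_span κ (Z N) x)
  simp only [hk] at h3 ⊢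
  have h4 := hC' _ k N _ (fun y hy => by
    rcases Finset.mem_insert.1 hy with rfl | hy
    · exact hN1.trans hNN1
    · exact hZN N y hy) (Nat.cast_nonneg N) h3
  rw [dist_zero_right, Real.norm_of_nonneg (integral_nonneg fun _ => abs_nonneg _)]
  refine h4.trans_lt ?_
  rw [mul_div_assoc', div_lt_iff₀ (by positivity)]
  nlinarith

theorem integral_inner_mul_eq_zero (ha : 0 < a) (hb : 0 < b) (hc : 0 < c)
    (hκ : ∀ x y, ⟪κ x, κ y⟫_ℝ = kerG a b c (x - y)) {f w : ℝ → ℝ} (hf : Continuous f) {F : ℝ}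
    (hF : ∀ t, |f t| ≤ F) (hw : ∀ x, w x = ∫ s, kerG a b c (x - s) * f s) {Z : Finset ℝ}
    (hZ : ∀ z ∈ Z, w z = 0) {p : H} (hp : p ∈ Submodule.span ℝ (κ '' (Z : Set ℝ))) :
    ∫ s, ⟪p, κ s⟫_ℝ * f s = 0 := by
  obtain ⟨k, rfl⟩ := (Submodule.mem_span_image_finset_iff_exists_fun' ℝ).1 hp
  have hint : ∀ z, Integrable fun s => kerG a b c (z - s) * f s := fun z =>
    integrable_mul_of_bounded ((integrable_kerG ha hb hc).comp_sub_left z) hf hF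
  have e : ∀ s, ⟪∑ z ∈ Z, k z • κ z, κ s⟫_ℝ * f s = ∑ z ∈ Z, k z * (kerG a b c (z - s) * f s) :=
    fun s => by
      rw [sum_inner, Finset.sum_mul]
      exact Finset.sum_congr rfl fun z _ => by rw [real_inner_smul_left, hκ, mul_assoc]
  simp only [e]
  rw [integral_finsetSum _ fun z _ => (hint z).const_mul _]
  exact Finset.sum_eq_zero fun z hz => by rw [integral_const_mul, ← hw, hZ z hz, mul_zero]

theorem integral_abs_residual_mul_le [CompleteSpace H] (ha : 0 < a) (hab : a < b) (hbc : b < c)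
    (hκ : ∀ x y, ⟪κ x, κ y⟫_ℝ = kerG a b c (x - y)) {f w : ℝ → ℝ} (hf : Continuous f) {F : ℝ}
    (hF : ∀ t, |f t| ≤ F) (hw : ∀ x, w x = ∫ s, kerG a b c (x - s) * f s) {Z : Finset ℝ}
    (hZ : ∀ z ∈ Z, w z = 0) {R : ℝ}
    (hsign : ∀ s ∈ Icc (-R) R, ∀ t ∈ Icc (-R) R, 0 ≤ (parity Z s * f s) * (parity Z t * f t))
    (x : ℝ) : ∫ s in Icc (-R) R, |⟪residual κ Z x, κ s⟫_ℝ * f s| ≤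
      |w x| + (∫ s in (Icc (-R) R)ᶜ, |⟪residual κ Z x, κ s⟫_ℝ|) * F := by
  have hb : 0 < b := ha.trans hab
  have hc : 0 < c := hb.trans hbc
  have hspan : ∀ {X : Finset ℝ} {p : H}, p ∈ Submodule.span ℝ (κ '' (X : Set ℝ)) →
      Integrable fun s => ⟪p, κ s⟫_ℝ := fun {X p} hp => by
    obtain ⟨k, -, hk⟩ := exists_inner_eq_sum_of_mem_span hκ hp
    simp only [hk]
    exact integrable_sum_kerG ha hb hc X k
  have hi := hspan (residual_mem_span κ Z x)
  have hif := integrable_mul_of_bounded hi hf hF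
  have htot : ∫ s, ⟪residual κ Z x, κ s⟫_ℝ * f s = w x := by
    obtain ⟨p, hp, h⟩ := exists_residual_eq κ Z x
    have h0 := integral_inner_mul_eq_zero ha hb hc hκ hf hF hw hZ hp
    have hip := integrable_mul_of_bounded (hspan hp) hf hF
    have hix : Integrable fun s => kerG a b c (x - s) * f s :=
      integrable_mul_of_bounded ((integrable_kerG ha hb hc).comp_sub_left x) hf hF
    have e : ∀ s, ⟪residual κ Z x, κ s⟫_ℝ * f s = kerG a b c (x - s) * f s - ⟪p, κ s⟫_ℝ * f s :=
      fun s => by rw [h, inner_sub_left, hκ, sub_mul]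
    simp only [e]
    rw [integral_sub hix hip, h0, sub_zero, hw]
  rw [abs_setIntegral_eq measurableSet_Icc fun s hs t ht => ?_]
  · have h1 := integral_add_compl (s := Icc (-R) R) measurableSet_Icc hif
    rw [htot] at h1
    have h2 : |∫ s in (Icc (-R) R)ᶜ, ⟪residual κ Z x, κ s⟫_ℝ * f s| ≤
        (∫ s in (Icc (-R) R)ᶜ, |⟪residual κ Z x, κ s⟫_ℝ|) * F := by
      rw [← integral_mul_const, ← Real.norm_eq_abs]
      refine norm_integral_le_of_norm_le (hi.abs.integrableOn.mul_const F) (ae_of_all _ fun s => ?_)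
      rw [norm_mul]
      exact mul_le_mul_of_nonneg_left (hF s) (norm_nonneg _)
    rw [eq_sub_of_add_eq h1]
    exact (abs_sub _ _).trans (by linarith)
  · have h1 := sign_inner ha hab hbc hκ (residual_mem_span κ Z x)
      (fun z hz => inner_residual_eq_zero κ x hz) s t
    have h2 := mul_nonneg h1 (hsign s hs t ht)
    have e1 := parity_sq Z s
    have e2 := parity_sq Z t
    have : ∀ P Q u v f g : ℝ, (P * u) * (Q * v) * ((P * f) * (Q * g)) =
        (P * P) * (Q * Q) * (u * f * (v * g)) := fun P Q u v f g => by ring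
    rwa [this, e1, e2, one_mul, one_mul] at h2

end Gram

theorem exists_abs_integral_mul_lt_one {q f : ℝ → ℝ} (hq : Continuous q) (hf : Continuous f)
    {ε C : ℝ} (hε : 0 < ε) (hqs : ∀ s ∉ Icc (-ε) ε, q s = 0)
    (hf0 : ∀ s ∈ Icc (-ε) ε, s ≠ 0 → f s ≠ 0) (hC : 0 ≤ C) :
    ∃ e, 0 < e ∧ ∀ ψ : ℝ → ℝ, Continuous ψ → (∀ s, |ψ s| ≤ C) →
      ∫ s in Icc (-ε) ε, |ψ s * f s| ≤ e → |∫ s, q s * ψ s| < 1 := by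
  obtain ⟨Q₀, hQ₀⟩ := isCompact_Icc.exists_bound_of_continuousOn (s := Icc (-ε) ε) hq.continuousOn
  set Q := |Q₀| + 1 with hQdef
  have hQ : 0 < Q := by positivity
  have hqQ : ∀ s ∈ Icc (-ε) ε, |q s| ≤ Q := fun s hs => by
    have := hQ₀ s hs
    rw [Real.norm_eq_abs] at this
    linarith [le_abs_self Q₀]
  set δ := min ε (1 / (8 * (Q * C + 1))) with hδdef
  have hδ : 0 < δ := lt_min hε (by positivity)
  have hδε : δ ≤ ε := min_le_left _ _
  have hδ' : Q * C * (2 * δ) ≤ 1 / 4 := by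
    have h1 : δ * (8 * (Q * C + 1)) ≤ 1 := by
      rw [← le_div_iff₀ (by positivity)]; exact min_le_right _ _
    nlinarith
  have hK : IsCompact (Icc (-ε) ε ∩ {s | δ ≤ |s|}) :=
    isCompact_Icc.inter_right (isClosed_le continuous_const continuous_abs)
  obtain ⟨s₀, ⟨hs₀, hs₀'⟩, hmin⟩ := hK.exists_isMinOn ⟨ε, ⟨by linarith, le_rfl⟩, by
    simpa [abs_of_pos hε] using hδε⟩ (continuous_abs.comp hf).continuousOn
  have hm : 0 < |f s₀| := abs_pos.2 (hf0 s₀ hs₀ (abs_pos.1 (hδ.trans_le hs₀')))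
  set m := |f s₀| with hmdef
  refine ⟨m / (4 * Q), by positivity, fun ψ hψ hψC h => ?_⟩
  have h1 : ∫ s, q s * ψ s = ∫ s in Icc (-ε) ε, q s * ψ s :=
    (setIntegral_eq_integral_of_forall_compl_eq_zero fun s hs => by rw [hqs s hs, zero_mul]).symm
  have hJ : IntegrableOn ((Icc (-δ) δ).indicator fun _ : ℝ => Q * C) (Icc (-ε) ε) :=
    ((integrableOn_const (by simp) enorm_ne_top).integrable_indicator measurableSet_Icc).integrableOn
  have hψf : IntegrableOn (fun s => Q / m * |ψ s * f s|) (Icc (-ε) ε) :=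
    (continuous_const.mul (hψ.mul hf).abs).continuousOn.integrableOn_compact isCompact_Icc
  have h2 : ‖∫ s in Icc (-ε) ε, q s * ψ s‖ ≤
      ∫ s in Icc (-ε) ε, ((Icc (-δ) δ).indicator (fun _ => Q * C) s + Q / m * |ψ s * f s|) := by
    refine norm_integral_le_of_norm_le (hJ.add hψf)
      ((ae_restrict_iff' measurableSet_Icc).2 (ae_of_all _ fun s hs => ?_))
    rw [norm_mul, Real.norm_eq_abs, Real.norm_eq_abs]
    by_cases hsδ : s ∈ Icc (-δ) δ
    · rw [indicator_of_mem hsδ]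
      exact (mul_le_mul (hqQ s hs) (hψC s) (abs_nonneg _) hQ.le).trans
        (le_add_of_nonneg_right (by positivity))
    · rw [indicator_of_notMem hsδ, zero_add, abs_mul]
      have hsδ' : δ ≤ |s| := by
        by_contra! hlt
        exact hsδ (abs_le.1 hlt.le)
      have hms : m ≤ |f s| := hmin ⟨hs, hsδ'⟩
      have e : |ψ s| ≤ 1 / m * (|ψ s| * |f s|) := by
        rw [div_mul_eq_mul_div, one_mul, le_div_iff₀ hm]
        exact mul_le_mul_of_nonneg_left hms (abs_nonneg _)
      calc |q s| * |ψ s| ≤ Q * (1 / m * (|ψ s| * |f s|)) :=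
            mul_le_mul (hqQ s hs) e (abs_nonneg _) hQ.le
        _ = Q / m * (|ψ s| * |f s|) := by ring
  rw [integral_add hJ hψf, setIntegral_indicator measurableSet_Icc,
    inter_eq_self_of_subset_right (Icc_subset_Icc (by linarith) hδε), setIntegral_const,
    Real.volume_real_Icc_of_le (by linarith), integral_const_mul, smul_eq_mul, Real.norm_eq_abs,
    ← h1] at h2
  have h3 : Q / m * ∫ s in Icc (-ε) ε, |ψ s * f s| ≤ 1 / 4 := by
    refine (mul_le_mul_of_nonneg_left h (by positivity)).trans (le_of_eq ?_)
    field_simp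
  nlinarith

section Gram

variable {H : Type*} [NormedAddCommGroup H] [InnerProductSpace ℝ H] {κ : ℝ → H} {a b c : ℝ}

theorem exists_pos_le_abs_mul_abs [CompleteSpace H] (ha : 0 < a) (hab : a < b) (hbc : b < c)
    (hκ : ∀ x y, ⟪κ x, κ y⟫_ℝ = kerG a b c (x - y)) {f w : ℝ → ℝ} {F : ℝ} (hf : Continuous f)
    (hF : ∀ s, |f s| ≤ F) (hw : ∀ x, w x = ∫ s, kerG a b c (x - s) * f s) {Z : ℕ → Finset ℝ}
    (hZ : Monotone Z) (hZN : ∀ N, ∀ z ∈ Z N, |z| ≤ N) (hwZ : ∀ N, ∀ z ∈ Z N, w z = 0)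
    (hsign : ∀ N : ℕ, ∀ s ∈ Icc (-(N : ℝ)) N, ∀ t ∈ Icc (-(N : ℝ)) N,
      0 ≤ (parity (Z N) s * f s) * (parity (Z N) t * f t)) {ε : ℝ} (hε : 0 < ε)
    (hf0 : ∀ s ∈ Icc (-ε) ε, s ≠ 0 → f s ≠ 0) {η : ℝ → ℝ} (hη : ContDiff ℝ 6 η)
    (hηε : tsupport η ⊆ Icc (-ε) ε) (hηZ : ∀ N, ∀ z ∈ Z N, η z = 0) {C : ℝ} (hC : 0 ≤ C) :
    ∃ e, 0 < e ∧ ∀ x l : ℝ, l * η x = 1 →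
      (∀ᶠ N in atTop, |l| * (‖residual κ (Z N) x‖ * √(kerG a b c 0)) ≤ C) → e ≤ |l| * |w x| := by
  obtain ⟨q, g, hq, hqη, hg, hgη⟩ := exists_test_vector ha hab hbc hκ hη
    (isCompact_Icc.of_isClosed_subset (isClosed_tsupport η) hηε)
  obtain ⟨e, he, hlt⟩ := exists_abs_integral_mul_lt_one hq hf hε
    (fun s hs => hqη s fun h => hs (hηε h)) hf0 hC
  refine ⟨e, he, fun x l hl hres => ?_⟩
  by_contra! hsmall
  have ht := (tendsto_integral_residual_compl ha hab hbc hκ hZ hZN x).mul_const (|l| * F)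
  rw [zero_mul] at ht
  obtain ⟨N, hNt, hNres, hNε⟩ := ((ht.eventually (gt_mem_nhds (sub_pos.2 hsmall))).and
    (hres.and (tendsto_natCast_atTop_atTop.eventually_ge_atTop ε))).exists
  have hcont : Continuous fun s => ⟪residual κ (Z N) x, κ s⟫_ℝ :=
    continuous_const.inner (continuous_of_gram hκ)
  have hint := integral_abs_residual_mul_le ha hab hbc hκ hf hF hw (hwZ N) (hsign N) x
  have h1 := hlt (fun s => l * ⟪residual κ (Z N) x, κ s⟫_ℝ) (continuous_const.mul hcont)
    (fun s => by
      rw [abs_mul]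
      exact (mul_le_mul_of_nonneg_left (abs_inner_le_of_gram hκ _ s) (abs_nonneg l)).trans hNres)
    (by
      simp only [mul_assoc, abs_mul l]
      rw [integral_const_mul]
      have hmono := setIntegral_mono_set (μ := volume) (s := Icc (-ε) ε) (t := Icc (-(N : ℝ)) N)
        (f := fun s => |⟪residual κ (Z N) x, κ s⟫_ℝ * f s|)
        ((hcont.mul hf).abs.continuousOn.integrableOn_compact isCompact_Icc)
        (ae_of_all _ fun s => abs_nonneg _)
        (Icc_subset_Icc (neg_le_neg hNε) hNε).eventuallyLE
      have := mul_le_mul_of_nonneg_left (hmono.trans hint) (abs_nonneg l)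
      linarith)
  have h2 : ∫ s, q s * (l * ⟪residual κ (Z N) x, κ s⟫_ℝ) = 1 := by
    have : ∀ s, q s * (l * ⟪residual κ (Z N) x, κ s⟫_ℝ) =
        l * (q s * ⟪residual κ (Z N) x, κ s⟫_ℝ) := fun s => by ring
    simp only [this]
    rw [integral_const_mul, ← hg, inner_residual_eq κ x fun z hz => by rw [hgη, hηZ N z hz], hgη, hl]
  rw [h2, abs_one] at h1
  exact lt_irrefl _ h1

theorem false_of_sign_changes (ha : 0 < a) (hab : a < b) (hbc : b < c)
    {f w : ℝ → ℝ} {F : ℝ} (hf : Continuous f)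
    (hF : ∀ s, |f s| ≤ F) (hw : ∀ x, w x = ∫ s, kerG a b c (x - s) * f s) (hw0 : w 0 = 0)
    (hw1 : HasDerivAt w 0 0) {Z : ℕ → Finset ℝ}
    (hZ : Monotone Z) (hZN : ∀ N, ∀ z ∈ Z N, |z| ≤ N) (hwZ : ∀ N, ∀ z ∈ Z N, w z = 0)
    (hsign : ∀ N : ℕ, ∀ s ∈ Icc (-(N : ℝ)) N, ∀ t ∈ Icc (-(N : ℝ)) N,
      0 ≤ (parity (Z N) s * f s) * (parity (Z N) t * f t)) {ε : ℝ} (hε : 0 < ε)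
    (hf0 : ∀ s ∈ Icc (-ε) ε, s ≠ 0 → f s ≠ 0)
    (hZε : ∀ N, ∀ z ∈ Z N, z ∈ Icc (-ε) ε → z = 0) : False := by
  obtain ⟨κ, hκ⟩ := exists_kerG_features ha hab hbc
  let β : ContDiffBump (0 : ℝ) := ⟨ε / 2, ε, by positivity, by linarith⟩
  have hβ : ContDiff ℝ 6 β := β.contDiff
  have hβε : tsupport β ⊆ Icc (-ε) ε := by
    rw [β.tsupport_eq, Real.closedBall_eq_Icc, zero_sub, zero_add]
  have hβ1 : ∀ x, |x| ≤ ε / 2 → β x = 1 := fun x hx =>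
    β.one_of_mem_closedBall (by rwa [mem_closedBall_zero_iff, Real.norm_eq_abs])
  by_cases h0 : ∃ N, (0 : ℝ) ∈ Z N
  · obtain ⟨N₀, hN₀⟩ := h0
    obtain ⟨C, hC, hκC⟩ := exists_norm_sub_le_of_gram ha hab hbc hκ
    obtain ⟨e, he, h⟩ := exists_pos_le_abs_mul_abs ha hab hbc hκ hf hF hw hZ hZN hwZ hsign hε hf0
      (η := fun t => t * β t) (contDiff_id.mul hβ) ((tsupport_mul_subset_right).trans hβε)
      (fun N z hz => by
        by_cases hz' : z ∈ Icc (-ε) ε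
        · rw [hZε N z hz hz', zero_mul]
        · rw [image_eq_zero_of_notMem_tsupport fun hh => hz' (hβε hh), mul_zero])
      (C := C * √(kerG a b c 0)) (by positivity)
    have h1 := (hasDerivAt_iff_isLittleO_nhds_zero.1 hw1).def (half_pos he)
    obtain ⟨δ, hδ, h2⟩ := Metric.eventually_nhds_iff.1 h1
    set x := min (δ / 2) (ε / 2) with hx
    have hx0 : 0 < x := lt_min (by positivity) (by positivity)
    have h3 := h2 (y := x) (by
      rw [dist_zero_right, Real.norm_of_nonneg hx0.le]
      exact (min_le_left _ _).trans_lt (by linarith))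
    simp only [zero_add, hw0, sub_zero, smul_zero, Real.norm_eq_abs] at h3
    have h4 := h x x⁻¹ (by
      rw [hβ1 x (by rw [abs_of_pos hx0]; exact min_le_right _ _), mul_one, inv_mul_cancel₀ hx0.ne'])
      (by
        filter_upwards [eventually_ge_atTop N₀] with N hN
        have h5 := (norm_residual_le κ (Z N) x
          (Submodule.subset_span ⟨0, by exact_mod_cast hZ hN hN₀, rfl⟩)).trans (hκC x)
        rw [← mul_assoc]
        refine mul_le_mul_of_nonneg_right ?_ (Real.sqrt_nonneg _)
        rw [abs_inv, inv_mul_le_iff₀ (abs_pos.2 hx0.ne'), mul_comm]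
        exact h5)
    rw [abs_inv, le_inv_mul_iff₀ (abs_pos.2 hx0.ne')] at h4
    have := mul_pos he (abs_pos.2 hx0.ne')
    linarith
  · push Not at h0
    obtain ⟨e, he, h⟩ := exists_pos_le_abs_mul_abs ha hab hbc hκ hf hF hw hZ hZN hwZ hsign hε hf0
      hβ hβε (fun N z hz => image_eq_zero_of_notMem_tsupport fun hh =>
        h0 N (hZε N z hz (hβε hh) ▸ hz)) (C := ‖κ 0‖ * √(kerG a b c 0)) (by positivity)
    have h4 := h 0 1 (by rw [hβ1 0 (by rw [abs_zero]; positivity), mul_one])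
      (Eventually.of_forall fun N => by
        rw [abs_one, one_mul]
        refine mul_le_mul_of_nonneg_right ?_ (Real.sqrt_nonneg _)
        simpa using norm_residual_le κ (Z N) 0 (Submodule.zero_mem _))
    rw [hw0, abs_zero, mul_zero] at h4
    exact absurd h4 (not_le.2 he)

end Gram

theorem eq_zero_of_norm_deriv_le {E : Type*} [NormedAddCommGroup E] [NormedSpace ℝ E] {f f' : ℝ → E}
    {K x : ℝ} (hf : ∀ t, HasDerivAt f (f' t) t) (hK : ∀ t, ‖f' t‖ ≤ K * ‖f t‖) (hx : f x = 0) (t : ℝ) :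
    f t = 0 := by
  rcases le_total x t with h | h
  · exact eq_zero_of_abs_deriv_le_mul_abs_self_of_eq_zero_right
      (fun s _ => (hf s).continuousAt.continuousWithinAt) (fun s _ => (hf s).hasDerivWithinAt) hx
      (fun s _ => hK s) t ⟨h, le_rfl⟩
  · have h1 : ∀ s, HasDerivAt (fun s => f (-s)) (-f' (-s)) s := fun s =>
      ((hf (-s)).scomp s (hasDerivAt_neg s)).congr_deriv (by simp)
    have := eq_zero_of_abs_deriv_le_mul_abs_self_of_eq_zero_right (a := -x) (b := -t)
      (f := fun s => f (-s))
      (fun s _ => (h1 s).continuousAt.continuousWithinAt) (fun s _ => (h1 s).hasDerivWithinAt)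
      (by simpa using hx) (fun s _ => by rw [norm_neg]; exact hK (-s)) (-t) ⟨by linarith, le_rfl⟩
    simpa using this

theorem eq_zero_of_linear_bound {W : ℕ → ℝ → ℝ} {L x : ℝ}
    (hW : ∀ j < 6, ∀ t, HasDerivAt (W j) (W (j + 1) t) t)
    (hL : ∀ t, |W 6 t| ≤ L * (|W 0 t| + |W 2 t| + |W 4 t|)) (hx : ∀ j < 6, W j x = 0) (t : ℝ) :
    W 0 t = 0 := by
  have hY : ∀ t, HasDerivAt (fun t (j : Fin 6) => W j t) (fun j : Fin 6 => W (j + 1) t) t := fun t =>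
    hasDerivAt_pi.2 fun j => hW j j.2 t
  have h := eq_zero_of_norm_deriv_le (K := 1 + 3 * |L|) (x := x) hY (fun t => by
    have hle : ∀ j (hj : j < 6), |W j t| ≤ ‖fun j : Fin 6 => W j t‖ := fun j hj =>
      norm_le_pi_norm (fun j : Fin 6 => W j t) ⟨j, hj⟩
    have hN := norm_nonneg fun j : Fin 6 => W j t
    refine (pi_norm_le_iff_of_nonneg (by positivity)).2 fun j => ?_
    rw [Real.norm_eq_abs]
    by_cases hj : (j : ℕ) + 1 < 6
    · have := hle _ hj
      nlinarith [mul_nonneg (abs_nonneg L) hN]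
    · have hj6 : (j : ℕ) + 1 = 6 := by omega
      rw [hj6]
      have h1 := (hL t).trans (mul_le_mul_of_nonneg_right (le_abs_self L) (by positivity))
      have h2 : |L| * (|W 0 t| + |W 2 t| + |W 4 t|) ≤ |L| * (3 * ‖fun j : Fin 6 => W j t‖) :=
        mul_le_mul_of_nonneg_left (by
          linarith [hle 0 (by norm_num), hle 2 (by norm_num), hle 4 (by norm_num)]) (abs_nonneg L)
      nlinarith)
    (funext fun j => hx j j.2) t
  exact congrFun h 0

theorem frequently_deriv_eq_zero {f f' : ℝ → ℝ} {x : ℝ} (hf : ∀ t, HasDerivAt f (f' t) t)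
    (hx : ∃ᶠ t in 𝓝[≠] x, f t = 0) : f x = 0 ∧ ∃ᶠ t in 𝓝[≠] x, f' t = 0 := by
  have h0 : f x = 0 := isClosed_singleton.mem_of_frequently_of_tendsto (s := {(0 : ℝ)}) hx
    ((hf x).continuousAt.tendsto.mono_left nhdsWithin_le_nhds)
  have hc : Continuous f := continuous_iff_continuousAt.2 fun t => (hf t).continuousAt
  refine ⟨h0, frequently_iff.2 fun {U} hU => ?_⟩
  obtain ⟨ε, hε, hεU⟩ := Metric.mem_nhdsWithin_iff.1 hU
  obtain ⟨t, ⟨ht1, ht2⟩, ht0⟩ := frequently_iff.1 hx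
    (inter_mem_nhdsWithin {x}ᶜ (Metric.ball_mem_nhds x hε))
  rw [Real.ball_eq_Ioo] at hεU ht2
  rcases lt_or_gt_of_ne (show t ≠ x from ht1) with h | h
  · obtain ⟨r, hr, hr'⟩ := exists_hasDerivAt_eq_zero h hc.continuousOn (ht0.trans h0.symm)
      fun t _ => hf t
    exact ⟨r, hεU ⟨⟨ht2.1.trans hr.1, by linarith [hr.2]⟩, hr.2.ne⟩, hr'⟩
  · obtain ⟨r, hr, hr'⟩ := exists_hasDerivAt_eq_zero h hc.continuousOn (h0.trans ht0.symm)
      fun t _ => hf t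
    exact ⟨r, hεU ⟨⟨by linarith [hr.1], hr.2.trans ht2.2⟩, hr.1.ne'⟩, hr'⟩

theorem eventually_ne_zero_of_linear_bound {W : ℕ → ℝ → ℝ} {L y : ℝ}
    (hW : ∀ j < 6, ∀ t, HasDerivAt (W j) (W (j + 1) t) t)
    (hL : ∀ t, |W 6 t| ≤ L * (|W 0 t| + |W 2 t| + |W 4 t|)) (hy : W 0 y ≠ 0) (x : ℝ) :
    ∀ᶠ t in 𝓝[≠] x, W 0 t ≠ 0 := by
  by_contra h
  have h' : ∃ᶠ t in 𝓝[≠] x, W 0 t = 0 := by simpa using h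
  have key : ∀ j ≤ 6, ∃ᶠ t in 𝓝[≠] x, W j t = 0 := by
    intro j
    induction j with
    | zero => exact fun _ => h'
    | succ j ih => exact fun hj => (frequently_deriv_eq_zero (hW j hj) (ih (by omega))).2
  exact hy (eq_zero_of_linear_bound hW hL
    (fun j hj => (frequently_deriv_eq_zero (hW j hj) (key j hj.le)).1) y)

theorem finite_zeros_of_eventually_ne {w : ℝ → ℝ} (h : ∀ x, ∀ᶠ t in 𝓝[≠] x, w t ≠ 0) (R : ℝ) :
    {t | t ∈ Icc (-R) R ∧ w t = 0}.Finite := by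
  by_contra hinf
  obtain ⟨x, -, hx⟩ := Set.Infinite.exists_accPt_of_subset_isCompact hinf
    (isCompact_Icc (a := -R) (b := R)) fun t ht => ht.1
  rw [accPt_iff_frequently_nhdsNE] at hx
  obtain ⟨t, ht1, ht2⟩ := (hx.and_eventually (h x)).exists
  exact ht2 ht1.2

theorem mul_pos_of_forall_ne_zero {w : ℝ → ℝ} (hw : Continuous w) {s t : ℝ} (hst : s ≤ t)
    (h : ∀ x ∈ Icc s t, w x ≠ 0) : 0 < w s * w t := by
  by_contra! hneg
  have h0 : (0 : ℝ) ∈ uIcc (w s) (w t) := by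
    rw [mem_uIcc]
    rcases mul_nonpos_iff.1 hneg with h' | h'
    · exact Or.inr ⟨h'.2, h'.1⟩
    · exact Or.inl h'
  obtain ⟨x, hx, hx0⟩ := intermediate_value_uIcc hw.continuousOn h0
  rw [uIcc_of_le hst] at hx
  exact h x hx hx0

/-- `w` takes both strict signs in every neighbourhood of `z`. -/
def IsSignChange (w : ℝ → ℝ) (z : ℝ) : Prop :=
  ∀ δ > 0, ∃ s ∈ Ioo (z - δ) (z + δ), ∃ t ∈ Ioo (z - δ) (z + δ), w s * w t < 0

theorem IsSignChange.eq_zero {w : ℝ → ℝ} (hw : Continuous w) {z : ℝ} (hz : IsSignChange w z) :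
    w z = 0 := by
  by_contra h
  obtain ⟨δ, hδ, hδw⟩ := Metric.eventually_nhds_iff.1 (hw.continuousAt.eventually_ne h)
  obtain ⟨s, hs, t, ht, hst⟩ := hz δ hδ
  rw [← Real.ball_eq_Ioo] at hs ht
  have hne : ∀ x ∈ Metric.ball z δ, w x ≠ 0 := fun x hx => hδw hx
  have hc : ∀ s ∈ Metric.ball z δ, ∀ t ∈ Metric.ball z δ, s ≤ t → 0 < w s * w t :=
    fun s hs t ht hle => mul_pos_of_forall_ne_zero hw hle fun x hx => hne x
      ((convex_ball z δ).ordConnected.out hs ht hx)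
  rcases le_total s t with hle | hle
  · exact (hc s hs t ht hle).not_gt hst
  · exact (hc t ht s hs hle).not_gt (by rwa [mul_comm])

theorem parity_eq_mul {Z : Finset ℝ} {s t : ℝ} (hst : s ≤ t) :
    parity Z t = parity Z s * (-1) ^ (Z.filter fun x => s ≤ x ∧ x < t).card := by
  have : Z.filter (· < t) = Z.filter (· < s) ∪ Z.filter fun x => s ≤ x ∧ x < t := by
    ext x
    simp only [Finset.mem_filter, Finset.mem_union]
    constructor
    · rintro ⟨h1, h2⟩
      rcases lt_or_ge x s with h | h
      · exact Or.inl ⟨h1, h⟩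
      · exact Or.inr ⟨h1, h, h2⟩
    · rintro (⟨h1, h2⟩ | ⟨h1, -, h2⟩)
      · exact ⟨h1, h2.trans_le hst⟩
      · exact ⟨h1, h2⟩
  rw [parity, this, Finset.card_union_of_disjoint, pow_add, ← parity]
  rw [Finset.disjoint_left]
  intro x h1 h2
  exact (Finset.mem_filter.1 h1).2.not_ge (Finset.mem_filter.1 h2).2.1

theorem parity_eq_of_forall_notMem {Z : Finset ℝ} {s t : ℝ} (hst : s ≤ t) (h : ∀ x ∈ Icc s t, x ∉ Z) :
    parity Z t = parity Z s := by
  rw [parity_eq_mul hst, Finset.filter_false_of_mem fun x hx hx' => h x ⟨hx'.1, hx'.2.le⟩ hx]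
  simp

theorem parity_eq_neg {Z : Finset ℝ} {s z t : ℝ} (hsz : s < z) (hzt : z < t) (hz : z ∈ Z)
    (h : ∀ x ∈ Icc s t, x ∈ Z → x = z) : parity Z t = -parity Z s := by
  have : Z.filter (fun x => s ≤ x ∧ x < t) = {z} := by
    ext x
    simp only [Finset.mem_filter, Finset.mem_singleton]
    constructor
    · rintro ⟨h1, h2, h3⟩
      exact h x ⟨h2, h3.le⟩ h1
    · rintro rfl
      exact ⟨hz, hsz.le, hzt⟩
  rw [parity_eq_mul (hsz.trans hzt).le, this]
  simp

theorem parity_mul_pos_of_unique_zero {w : ℝ → ℝ} (hw : Continuous w) {Z : Finset ℝ} {u z v : ℝ}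
    (huz : u < z) (hzv : z < v) (hne : ∀ x ∈ Icc u v, x ≠ z → w x ≠ 0)
    (hZ : ∀ x ∈ Icc u v, (x ∈ Z ↔ IsSignChange w x)) :
    0 < (parity Z u * w u) * (parity Z v * w v) := by
  have hZw : ∀ x ∈ Icc u v, x ∈ Z → x = z := fun x hx hxZ => by
    by_contra h
    exact hne x hx h (((hZ x hx).1 hxZ).eq_zero hw)
  have hl : ∀ s ∈ Ico u z, 0 < w u * w s := fun s hs =>
    mul_pos_of_forall_ne_zero hw hs.1 fun x hx =>
      hne x ⟨hx.1, by linarith [hx.2, hs.2]⟩ (by linarith [hx.2, hs.2] : x < z).ne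
  have hr : ∀ t ∈ Ioc z v, 0 < w t * w v := fun t ht =>
    mul_pos_of_forall_ne_zero hw ht.2 fun x hx =>
      hne x ⟨by linarith [hx.1, ht.1], hx.2⟩ (by linarith [hx.1, ht.1] : z < x).ne'
  have hu : w u ≠ 0 := hne u ⟨le_rfl, (huz.trans hzv).le⟩ huz.ne
  have hv : w v ≠ 0 := hne v ⟨(huz.trans hzv).le, le_rfl⟩ hzv.ne'
  have hp := parity_sq Z u
  by_cases hz : z ∈ Z
  · rw [parity_eq_neg huz hzv hz hZw]
    have hneg : w u * w v < 0 := by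
      by_contra! h
      have huv : 0 < w u * w v := lt_of_le_of_ne h (mul_ne_zero hu hv).symm
      have hz0 := ((hZ z ⟨huz.le, hzv.le⟩).1 hz).eq_zero hw
      have hpos : ∀ s ∈ Ioo u v, 0 ≤ w u * w s := fun s hs => by
        rcases lt_trichotomy s z with h | h | h
        · exact (hl s ⟨hs.1.le, h⟩).le
        · rw [h, hz0, mul_zero]
        · have := hr s ⟨h, hs.2.le⟩
          have h3 : 0 < w u * w s * (w v * w v) := by nlinarith
          exact (pos_of_mul_pos_left h3 (mul_self_nonneg _)).le
      obtain ⟨s, hs, t, ht, hst⟩ := (hZ z ⟨huz.le, hzv.le⟩).1 hz (min (z - u) (v - z))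
        (lt_min (by linarith) (by linarith))
      have h1 := min_le_left (z - u) (v - z)
      have h2 := min_le_right (z - u) (v - z)
      have h3 := mul_nonneg (hpos s ⟨by linarith [hs.1], by linarith [hs.2]⟩)
        (hpos t ⟨by linarith [ht.1], by linarith [ht.2]⟩)
      have h4 : 0 < w u * w u := mul_self_pos.2 hu
      nlinarith
    nlinarith
  · rw [parity_eq_of_forall_notMem (huz.trans hzv).le fun x hx hxZ => hz (hZw x hx hxZ ▸ hxZ)]
    have hnot := mt (hZ z ⟨huz.le, hzv.le⟩).2 hz
    simp only [IsSignChange] at hnot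
    push Not at hnot
    obtain ⟨δ, hδ, hst⟩ := hnot
    set ρ := min (δ / 2) (min (z - u) (v - z)) with hρ
    have hρ0 : 0 < ρ := lt_min (by linarith) (lt_min (by linarith) (by linarith))
    have h1 : ρ ≤ δ / 2 := min_le_left _ _
    have h2 : ρ ≤ z - u := (min_le_right _ _).trans (min_le_left _ _)
    have h3 : ρ ≤ v - z := (min_le_right _ _).trans (min_le_right _ _)
    have e1 := hst (z - ρ) ⟨by linarith, by linarith⟩ (z + ρ) ⟨by linarith, by linarith⟩
    have e2 := hl (z - ρ) ⟨by linarith, by linarith⟩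
    have e3 := hr (z + ρ) ⟨by linarith, by linarith⟩
    have e4 : 0 ≤ w u * w v := by
      have e5 := mul_pos e2 e3
      by_contra! hneg
      nlinarith
    have e6 : 0 < w u * w v := lt_of_le_of_ne e4 (mul_ne_zero hu hv).symm
    nlinarith

theorem parity_mul_pos {w : ℝ → ℝ} (hw : Continuous w) {Z A : Finset ℝ} {s t : ℝ} (hst : s ≤ t)
    (hs : w s ≠ 0) (ht : w t ≠ 0) (hA : ∀ x ∈ Icc s t, w x = 0 → x ∈ A)
    (hZ : ∀ x ∈ Icc s t, (x ∈ Z ↔ IsSignChange w x)) :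
    0 < (parity Z s * w s) * (parity Z t * w t) := by
  induction hn : (A.filter (· ∈ Icc s t)).card using Nat.strong_induction_on generalizing s t with
  | _ n ih =>
  by_cases h0 : ∀ x ∈ Icc s t, w x ≠ 0
  · rw [parity_eq_of_forall_notMem hst fun x hx hxZ => h0 x hx (((hZ x hx).1 hxZ).eq_zero hw)]
    have h1 := parity_sq Z s
    have h2 := mul_pos_of_forall_ne_zero hw hst h0
    nlinarith
  · push Not at h0
    obtain ⟨z, hz, hz0⟩ := h0
    have hsz : s < z := lt_of_le_of_ne hz.1 (by rintro rfl; exact hs hz0)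
    have hzt : z < t := lt_of_le_of_ne hz.2 (by rintro rfl; exact ht hz0)
    have hnhds : ∀ᶠ x in 𝓝 z, x ∉ A.erase z ∧ x ∈ Ioo s t :=
      ((A.erase z).finite_toSet.isClosed.isOpen_compl.eventually_mem (by simp)).and
        (Ioo_mem_nhds hsz hzt)
    obtain ⟨δ, hδ, hδA⟩ := Metric.eventually_nhds_iff.1 hnhds
    have hb : ∀ x ∈ Icc (z - δ / 2) (z + δ / 2), x ∉ A.erase z ∧ x ∈ Ioo s t := fun x hx => hδA (by
      rw [Real.dist_eq, abs_lt]
      constructor <;> linarith [hx.1, hx.2])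
    have hu := hb (z - δ / 2) ⟨le_rfl, by linarith⟩
    have hv := hb (z + δ / 2) ⟨by linarith, le_rfl⟩
    have hne : ∀ x ∈ Icc (z - δ / 2) (z + δ / 2), x ≠ z → w x ≠ 0 := fun x hx hxz hx0 =>
      (hb x hx).1 (Finset.mem_erase.2 ⟨hxz, hA x (Ioo_subset_Icc_self (hb x hx).2) hx0⟩)
    have hzA : z ∈ A.filter (· ∈ Icc s t) := Finset.mem_filter.2 ⟨hA z hz hz0, hz⟩
    have hu0 := hne (z - δ / 2) ⟨le_rfl, by linarith⟩ (by linarith)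
    have hv0 := hne (z + δ / 2) ⟨by linarith, le_rfl⟩ (by linarith)
    have hsu : Icc s (z - δ / 2) ⊆ Icc s t := Icc_subset_Icc_right hu.2.2.le
    have hvt : Icc (z + δ / 2) t ⊆ Icc s t := Icc_subset_Icc_left hv.2.1.le
    have hlt : ∀ S : Set ℝ, ∀ [DecidablePred (· ∈ S)], S ⊆ Icc s t → z ∉ S →
        (A.filter (· ∈ S)).card < n := fun S _ hS hzS => by
      rw [← hn]
      refine Finset.card_lt_card ⟨fun x hx => ?_, fun h => hzS (Finset.mem_filter.1 (h hzA)).2⟩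
      rw [Finset.mem_filter] at hx ⊢
      exact ⟨hx.1, hS hx.2⟩
    have h1 := ih _ (hlt _ hsu fun h => by linarith [h.2]) hu.2.1.le hs hu0
      (fun x hx => hA x (hsu hx)) (fun x hx => hZ x (hsu hx)) rfl
    have h2 := ih _ (hlt _ hvt fun h => by linarith [h.1]) hv.2.2.le hv0 ht
      (fun x hx => hA x (hvt hx)) (fun x hx => hZ x (hvt hx)) rfl
    have h3 := parity_mul_pos_of_unique_zero hw (Z := Z) (by linarith : z - δ / 2 < z)
      (by linarith : z < z + δ / 2) hne
      (fun x hx => hZ x (Ioo_subset_Icc_self (hb x hx).2))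
    have h4 := mul_pos (mul_pos h1 h3) h2
    set p := parity Z s * w s
    set q := parity Z (z - δ / 2) * w (z - δ / 2)
    set r := parity Z (z + δ / 2) * w (z + δ / 2)
    set y := parity Z t * w t
    have h5 : 0 < p * y * ((q * r) * (q * r)) := by linarith [h4, (by ring :
      p * q * (q * r) * (r * y) = p * y * ((q * r) * (q * r)))]
    exact pos_of_mul_pos_left h5 (mul_self_nonneg _)

theorem eq_zero_of_double_zero {a b c : ℝ} (ha : 0 < a) (hab : a < b) (hbc : b < c)
    {W : ℕ → ℝ → ℝ} {f : ℝ → ℝ} (hW : ∀ j < 6, ∀ t, HasDerivAt (W j) (W (j + 1) t) t)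
    (hf : Continuous f)
    (heq : ∀ t, W 6 t - (a ^ 2 + b ^ 2 + c ^ 2) * W 4 t +
      (a ^ 2 * b ^ 2 + a ^ 2 * c ^ 2 + b ^ 2 * c ^ 2) * W 2 t - a ^ 2 * b ^ 2 * c ^ 2 * W 0 t = -f t)
    {M K : ℝ} (hM : ∀ t, |W 0 t| ≤ M) (hK : 0 ≤ K) (hfK : ∀ t, |f t| ≤ K * |W 0 t|)
    (hfW : ∀ t, W 0 t ≠ 0 → 0 < f t * W 0 t) (h0 : W 0 0 = 0) (h1 : W 1 0 = 0) (y : ℝ) :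
    W 0 y = 0 := by
  by_contra hy
  have hw : Continuous (W 0) :=
    continuous_iff_continuousAt.2 fun t => (hW 0 (by norm_num) t).continuousAt
  have hF : ∀ t, |f t| ≤ K * M := fun t => (hfK t).trans (mul_le_mul_of_nonneg_left (hM t) hK)
  set k₄ := a ^ 2 + b ^ 2 + c ^ 2 with hk₄
  set k₂ := a ^ 2 * b ^ 2 + a ^ 2 * c ^ 2 + b ^ 2 * c ^ 2 with hk₂
  set k₀ := a ^ 2 * b ^ 2 * c ^ 2 with hk₀
  have p₄ : 0 ≤ k₄ := by positivity
  have p₂ : 0 ≤ k₂ := by positivity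
  have p₀ : 0 ≤ k₀ := by positivity
  have hL : ∀ t, |W 6 t| ≤ (k₄ + k₂ + k₀ + K) * (|W 0 t| + |W 2 t| + |W 4 t|) := fun t => by
    have e : W 6 t = k₄ * W 4 t - k₂ * W 2 t + k₀ * W 0 t - f t := by linarith [heq t]
    have e1 : |W 6 t| ≤ k₄ * |W 4 t| + k₂ * |W 2 t| + k₀ * |W 0 t| + |f t| := by
      rw [e]
      refine (abs_sub _ _).trans (add_le_add ((abs_add_le _ _).trans (add_le_add
        ((abs_sub _ _).trans ?_) ?_)) le_rfl) <;> simp only [abs_mul, abs_of_nonneg p₄, abs_of_nonneg p₂, abs_of_nonneg p₀, le_refl]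
    have q₀ := abs_nonneg (W 0 t)
    have q₂ := abs_nonneg (W 2 t)
    have q₄ := abs_nonneg (W 4 t)
    nlinarith [hfK t, mul_nonneg p₄ q₀, mul_nonneg p₄ q₂, mul_nonneg p₂ q₀, mul_nonneg p₂ q₄,
      mul_nonneg p₀ q₂, mul_nonneg p₀ q₄, mul_nonneg hK q₂, mul_nonneg hK q₄]
  have hiso := eventually_ne_zero_of_linear_bound hW hL hy
  have hfin := finite_zeros_of_eventually_ne hiso
  obtain ⟨δ, hδ, hδ0⟩ := Metric.mem_nhdsWithin_iff.1 (hiso 0)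
  have hne : ∀ s ∈ Icc (-(δ / 2)) (δ / 2), s ≠ 0 → W 0 s ≠ 0 := fun s hs hs0 =>
    hδ0 ⟨by rw [Real.ball_eq_Ioo]; constructor <;> linarith [hs.1, hs.2], hs0⟩
  have hf0 : ∀ s, W 0 s ≠ 0 → f s ≠ 0 := fun s hs h => by
    have := hfW s hs
    rw [h, zero_mul] at this
    exact lt_irrefl _ this
  classical
  refine false_of_sign_changes ha hab hbc hf hF (eq_integral_kerG ha hab hbc hf hF hM hW heq) h0
    ((hW 0 (by norm_num) 0).congr_deriv h1) (Z := fun N : ℕ => (hfin N).toFinset.filter (IsSignChange (W 0)))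
    (fun m n hmn z hz => ?_) (fun N z hz => ?_) (fun N z hz => ?_) (fun N => ?_) (half_pos hδ)
    (fun s hs hs0 => hf0 s (hne s hs hs0)) (fun N z hz hzδ => ?_)
  · simp only [Finset.mem_filter, Finite.mem_toFinset, mem_ofPred_eq] at hz ⊢
    have : (m : ℝ) ≤ n := by exact_mod_cast hmn
    exact ⟨⟨Icc_subset_Icc (neg_le_neg this) this hz.1.1, hz.1.2⟩, hz.2⟩
  · simp only [Finset.mem_filter, Finite.mem_toFinset, mem_ofPred_eq] at hz
    exact abs_le.2 hz.1.1
  · exact (Finset.mem_filter.1 hz).2.eq_zero hw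
  · have key : ∀ s ∈ Icc (-(N : ℝ)) N, ∀ t ∈ Icc (-(N : ℝ)) N, s ≤ t →
        0 ≤ (parity ((hfin N).toFinset.filter (IsSignChange (W 0))) s * f s) *
          (parity ((hfin N).toFinset.filter (IsSignChange (W 0))) t * f t) := by
      intro s hs t ht hst
      have hz : ∀ s, W 0 s = 0 → f s = 0 := fun s h => by
        have := hfK s
        rw [h, abs_zero, mul_zero] at this
        exact abs_nonpos_iff.1 this
      by_cases hs0 : W 0 s = 0
      · rw [hz s hs0, mul_zero, zero_mul]
      by_cases ht0 : W 0 t = 0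
      · rw [hz t ht0, mul_zero, mul_zero]
      have hsub : Icc s t ⊆ Icc (-(N : ℝ)) N := Icc_subset_Icc hs.1 ht.2
      have h2 := parity_mul_pos hw (A := (hfin N).toFinset)
        (Z := (hfin N).toFinset.filter (IsSignChange (W 0))) hst hs0 ht0
        (fun x hx hx0 => (Finite.mem_toFinset _).2 ⟨hsub hx, hx0⟩)
        (fun x hx => by
          rw [Finset.mem_filter, Finite.mem_toFinset]
          exact ⟨fun h => h.2, fun h => ⟨⟨hsub hx, h.eq_zero hw⟩, h⟩⟩)
      set p := parity ((hfin N).toFinset.filter (IsSignChange (W 0))) s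
      set q := parity ((hfin N).toFinset.filter (IsSignChange (W 0))) t
      have h3 := mul_pos (hfW s hs0) (hfW t ht0)
      by_contra! hneg
      nlinarith [mul_self_nonneg (p * q)]
    intro s hs t ht
    rcases le_total s t with h | h
    · exact key s hs t ht h
    · rw [mul_comm]; exact key t ht s hs h
  · by_contra hz0
    exact hne z hzδ hz0 ((Finset.mem_filter.1 hz).2.eq_zero hw)

/-- The nonlinearity `x ↦ |x|^p x`. -/
def signedPow (p x : ℝ) : ℝ := |x| ^ p * x

theorem signedPow_neg (p x : ℝ) : signedPow p (-x) = -signedPow p x := by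
  rw [signedPow, signedPow, abs_neg, mul_neg]

theorem continuous_signedPow {p : ℝ} (hp : 0 ≤ p) : Continuous (signedPow p) :=
  (continuous_abs.rpow_const fun _ => Or.inr hp).mul continuous_id

theorem signedPow_of_nonneg {p x : ℝ} (hp : 0 ≤ p) (hx : 0 ≤ x) : signedPow p x = x ^ (p + 1) := by
  rw [signedPow, abs_of_nonneg hx, Real.rpow_add_of_nonneg hx hp zero_le_one, Real.rpow_one]

theorem signedPow_sub_le_of_nonneg {p M x y : ℝ} (hp : 0 ≤ p) (hx : 0 ≤ x) (hxy : x ≤ y)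
    (hy : y ≤ M) : signedPow p y - signedPow p x ≤ (p + 1) * M ^ p * (y - x) := by
  rw [signedPow_of_nonneg hp hx, signedPow_of_nonneg hp (hx.trans hxy)]
  have hd : ∀ z, HasDerivAt (fun z : ℝ => z ^ (p + 1)) ((p + 1) * z ^ p) z := fun z =>
    (Real.hasDerivAt_rpow_const (Or.inr (by linarith))).congr_deriv (by rw [add_sub_cancel_right])
  have := (convex_Icc x y).image_sub_le_mul_sub_of_deriv_le
    (f := fun z : ℝ => z ^ (p + 1)) (fun z _ => (hd z).continuousAt.continuousWithinAt)
    (fun z _ => (hd z).differentiableAt.differentiableWithinAt) (C := (p + 1) * M ^ p)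
    (fun z hz => by
      rw [interior_Icc] at hz
      rw [(hd z).deriv]
      exact mul_le_mul_of_nonneg_left (Real.rpow_le_rpow (hx.trans hz.1.le) (hz.2.le.trans hy) hp)
        (by linarith)) x ⟨le_rfl, hxy⟩ y ⟨hxy, le_rfl⟩ hxy
  exact this

theorem strictMono_signedPow {p : ℝ} (hp : 0 ≤ p) : StrictMono (signedPow p) := by
  refine strictMono_of_odd_strictMonoOn_nonneg (signedPow_neg p) fun x hx y hy hxy => ?_
  rw [signedPow_of_nonneg hp hx, signedPow_of_nonneg hp hy]
  exact Real.rpow_lt_rpow hx hxy (by linarith)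

theorem abs_signedPow_sub_le {p M x y : ℝ} (hp : 0 ≤ p) (hx : |x| ≤ M) (hy : |y| ≤ M) :
    |signedPow p x - signedPow p y| ≤ (p + 1) * M ^ p * |x - y| := by
  have key : ∀ {x y : ℝ}, |x| ≤ M → |y| ≤ M → x ≤ y →
      |signedPow p x - signedPow p y| ≤ (p + 1) * M ^ p * |x - y| := by
    intro x y hx hy hxy
    rw [abs_sub_comm, abs_sub_comm x y, abs_of_nonneg (sub_nonneg.2 hxy),
      abs_of_nonneg (sub_nonneg.2 ((strictMono_signedPow hp).monotone hxy))]
    rcases le_total 0 x with h | h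
    · exact signedPow_sub_le_of_nonneg hp h hxy ((le_abs_self y).trans hy)
    rcases le_total y 0 with h' | h'
    · have := signedPow_sub_le_of_nonneg hp (neg_nonneg.2 h') (neg_le_neg hxy)
        ((neg_le_abs x).trans hx)
      rw [signedPow_neg, signedPow_neg] at this
      linarith
    · have h1 := signedPow_sub_le_of_nonneg hp le_rfl h' ((le_abs_self y).trans hy)
      have h2 := signedPow_sub_le_of_nonneg hp le_rfl (neg_nonneg.2 h) ((neg_le_abs x).trans hx)
      rw [signedPow_neg] at h2
      have h3 : signedPow p 0 = 0 := mul_zero _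
      rw [h3] at h1 h2
      linarith
  rcases le_total x y with h | h
  · exact key hx hy h
  · rw [abs_sub_comm, abs_sub_comm x y]
    exact key hy hx h

theorem cN_pos {n : ℕ} (hn : 7 ≤ n) : 0 < cN n := by
  have h : (7 : ℝ) ≤ n := by exact_mod_cast hn
  have h2 : (49 : ℝ) ≤ (n : ℝ) ^ 2 := by nlinarith
  have : 0 < (n : ℝ) ^ 4 - 20 * (n : ℝ) ^ 2 + 64 := by nlinarith
  unfold cN
  have : 0 < (n : ℝ) - 6 := by linarith
  positivity

theorem IsSolO6.eq_of_initial_eq {n : ℕ} (hn : 7 ≤ n) {v₁ v₂ : ℝ → ℝ} (h₁ : IsSolO6 n v₁)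
    (h₂ : IsSolO6 n v₂) {M : ℝ} (hM₁ : ∀ t, |v₁ t| ≤ M) (hM₂ : ∀ t, |v₂ t| ≤ M)
    (h0 : v₁ 0 = v₂ 0) (h1 : deriv v₁ 0 = deriv v₂ 0) : v₁ = v₂ := by
  have h : (7 : ℝ) ≤ n := by exact_mod_cast hn
  set p : ℝ := 12 / ((n : ℝ) - 6) with hp
  have hp0 : 0 ≤ p := div_nonneg (by norm_num) (by linarith)
  have hc := cN_pos hn
  have hM0 : 0 ≤ M := (abs_nonneg _).trans (hM₁ 0)
  have key := eq_zero_of_double_zero (a := ((n : ℝ) - 6) / 2) (b := ((n : ℝ) - 2) / 2)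
    (c := ((n : ℝ) + 2) / 2) (by linarith) (by linarith) (by linarith)
    (W := fun j t => iteratedDeriv j v₁ t - iteratedDeriv j v₂ t)
    (f := fun t => cN n * (signedPow p (v₁ t) - signedPow p (v₂ t)))
    (fun j hj t => (hasDerivAt_iteratedDeriv h₁.1 hj t).sub (hasDerivAt_iteratedDeriv h₂.1 hj t))
    (continuous_const.mul (((continuous_signedPow hp0).comp h₁.1.continuous).sub
      ((continuous_signedPow hp0).comp h₂.1.continuous)))
    (fun t => by
      have e₁ := h₁.2 t
      have e₂ := h₂.2 t
      simp only [K0, K2, K4] at e₁ e₂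
      simp only [iteratedDeriv_zero, signedPow]
      rw [← hp] at e₁ e₂
      linear_combination e₁ - e₂)
    (M := M + M) (K := cN n * ((p + 1) * M ^ p))
    (fun t => by
      simp only [iteratedDeriv_zero]
      exact (abs_sub _ _).trans (add_le_add (hM₁ t) (hM₂ t)))
    (mul_nonneg hc.le (mul_nonneg (by linarith) (Real.rpow_nonneg hM0 p)))
    (fun t => by
      simp only [iteratedDeriv_zero]
      rw [abs_mul, abs_of_pos hc, mul_assoc]
      exact mul_le_mul_of_nonneg_left (abs_signedPow_sub_le hp0 (hM₁ t) (hM₂ t)) hc.le)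
    (fun t ht => by
      simp only [iteratedDeriv_zero] at ht ⊢
      rw [mul_assoc]
      refine mul_pos hc ?_
      rcases lt_or_gt_of_ne (sub_ne_zero.1 ht) with hlt | hlt
      · exact mul_pos_of_neg_of_neg (sub_neg.2 (strictMono_signedPow hp0 hlt)) (sub_neg.2 hlt)
      · exact mul_pos (sub_pos.2 (strictMono_signedPow hp0 hlt)) (sub_pos.2 hlt))
    (by simpa using sub_eq_zero.2 h0) (by simpa using sub_eq_zero.2 h1)
  funext t
  have := key t
  simp only [iteratedDeriv_zero] at this
  exact sub_eq_zero.1 this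

theorem IsSolO6.comp_const_add {n : ℕ} {v : ℝ → ℝ} (h : IsSolO6 n v) (s : ℝ) :
    IsSolO6 n fun t => v (s + t) := by
  refine ⟨h.1.comp (contDiff_const.add contDiff_id), fun t => ?_⟩
  simp only [iteratedDeriv_comp_const_add]
  exact h.2 (s + t)

theorem IsSolO6.comp_const_sub {n : ℕ} {v : ℝ → ℝ} (h : IsSolO6 n v) (s : ℝ) :
    IsSolO6 n fun t => v (s - t) := by
  refine ⟨h.1.comp (contDiff_const.sub contDiff_id), fun t => ?_⟩
  simp only [iteratedDeriv_comp_const_sub]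
  have := h.2 (s - t)
  norm_num
  exact this

theorem IsSolO6.neg {n : ℕ} {v : ℝ → ℝ} (h : IsSolO6 n v) : IsSolO6 n fun t => -v t := by
  refine ⟨h.1.neg, fun t => ?_⟩
  have := h.2 t
  simp only [iteratedDeriv_fun_neg, abs_neg]
  linarith

end SixthOrder

theorem symmetry_of_bounded_solutions
    (n : ℕ) (hn : 7 ≤ n) (v : ℝ → ℝ) (hv : IsSolO6 n v)
    (hb : ∃ M : ℝ, ∀ t : ℝ, |v t| ≤ M) (t₀ : ℝ) :
    (deriv v t₀ = 0 → ∀ t : ℝ, v (t₀ + t) = v (t₀ - t)) ∧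
    (v t₀ = 0 → ∀ t : ℝ, v (t₀ - t) = -v (t₀ + t)) := by
  obtain ⟨M, hM⟩ := hb
  have h₁ := SixthOrder.IsSolO6.comp_const_add hv t₀
  have h₂ := SixthOrder.IsSolO6.comp_const_sub hv t₀
  refine ⟨fun h t => ?_, fun h t => ?_⟩
  · refine congrFun (SixthOrder.IsSolO6.eq_of_initial_eq hn h₁ h₂ (fun t => hM _) (fun t => hM _)
      (by simp) ?_) t
    rw [deriv_comp_const_add, deriv_comp_const_sub, add_zero, sub_zero, h, neg_zero]
  · refine congrFun (SixthOrder.IsSolO6.eq_of_initial_eq hn h₂ (SixthOrder.IsSolO6.neg h₁)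
      (fun t => hM _) (fun t => by rw [abs_neg]; exact hM _) (by simp [h]) ?_) t
    rw [deriv.fun_neg, deriv_comp_const_add, deriv_comp_const_sub, add_zero, sub_zero]
end
end

section
/- Let v be a solution of the ODE (O6). Then v does not tend to +∞ and does not tend to -∞ as t → +∞, and likewise v does not tend to +∞ or -∞ as t → -∞. Consequently, if v(t) converges to a limit in the extended real line as t → +∞ (or as t → -∞), that limit is a real number. -/
noncomputable section

open Real

open Filter

theorem IsSolO6.neg {n : ℕ} {v : ℝ → ℝ} (hv : IsSolO6 n v) : IsSolO6 n (fun t => -v t) := by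
  refine ⟨hv.1.neg, fun t => ?_⟩
  have h := hv.2 t
  simp only [iteratedDeriv_fun_neg, abs_neg]
  linarith

theorem IsSolO6.hasDerivAt_iteratedDeriv {n : ℕ} {v : ℝ → ℝ} (hv : IsSolO6 n v) {k : ℕ}
    (hk : k < 6) (t : ℝ) :
    HasDerivAt (iteratedDeriv k v) (iteratedDeriv (k + 1) v t) t := by
  rw [iteratedDeriv_succ]
  exact (hv.1.differentiable_iteratedDeriv k (by exact_mod_cast hk) t).hasDerivAt

theorem cN_pos {n : ℕ} (hn : 7 ≤ n) : 0 < cN n := by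
  have h : (7 : ℝ) ≤ n := by exact_mod_cast hn
  have h1 : 0 < (n : ℝ) - 6 := by linarith
  have h2 : 0 < (n : ℝ) ^ 2 - 4 := by nlinarith
  have h3 : 0 < (n : ℝ) ^ 2 - 16 := by nlinarith
  have h4 : (n : ℝ) ^ 4 - 20 * (n : ℝ) ^ 2 + 64 = ((n : ℝ) ^ 2 - 4) * ((n : ℝ) ^ 2 - 16) := by
    ring
  unfold cN
  rw [h4]
  positivity

/-- A polynomial with positive constant term becomes positive on `[0, 1]` after adding a large
multiple of `x ^ 3`. -/
theorem exists_cubic_pos (a b c d : ℝ) (hd : 0 < d) :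
    ∃ M : ℝ, ∀ x : ℝ, 0 ≤ x → x ≤ 1 → 0 < d + a * x + b * x ^ 2 + (c + M) * x ^ 3 := by
  set A := |a| + |b| + 1 with hA
  have hApos : 0 < A := by positivity
  refine ⟨4 * A ^ 3 / d ^ 2 - c, fun x hx0 hx1 => ?_⟩
  have hax : -|a| * x ≤ a * x := mul_le_mul_of_nonneg_right (neg_abs_le a) hx0
  have hbx : -|b| * x ≤ b * x ^ 2 := by
    have h1 : -|b| * x ^ 2 ≤ b * x ^ 2 :=
      mul_le_mul_of_nonneg_right (neg_abs_le b) (sq_nonneg x)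
    have h2 : |b| * x ^ 2 ≤ |b| * x :=
      mul_le_mul_of_nonneg_left (by nlinarith) (abs_nonneg b)
    linarith
  have hy0 : 0 ≤ A * x / d := by positivity
  set y := A * x / d with hy
  have hAx : A * x = d * y := by rw [hy]; field_simp
  have hcube : (c + (4 * A ^ 3 / d ^ 2 - c)) * x ^ 3 = d * (4 * y ^ 3) := by
    rw [hy]; field_simp; ring
  have hpos : 0 < 1 - y + 4 * y ^ 3 := by
    nlinarith [mul_nonneg hy0 (sq_nonneg (2 * y - 1)), sq_nonneg (2 * y - 1), sq_nonneg (4 * y - 1)]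
  have := mul_pos hd hpos
  rw [hcube]
  have : A * x = |a| * x + |b| * x + x := by rw [hA]; ring
  linarith

/-- A solution of (O6) cannot stay above a large constant on an interval of length `π`: otherwise
the Lagrange bilinear concomitant of `v` and `sin ^ 6`, which vanishes at both endpoints, would be
strictly decreasing. -/
theorem IsSolO6.exists_lt_on_Icc {n : ℕ} (hn : 7 ≤ n) {v : ℝ → ℝ} (hv : IsSolO6 n v) :
    ∃ B : ℝ, ∀ T : ℝ, ∃ t ∈ Set.Icc T (T + π), v t < B := by
  obtain ⟨M, hM⟩ := exists_cubic_pos (-20160 - 360 * K4 n)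
    (63840 + 1560 * K4 n + 30 * K2 n) (-46656 - 1296 * K4 n - 36 * K2 n) 720 (by norm_num)
  have hq : 0 < 12 / ((n : ℝ) - 6) := by
    have h : (7 : ℝ) ≤ n := by exact_mod_cast hn
    have : 0 < (n : ℝ) - 6 := by linarith
    positivity
  obtain ⟨B, hB⟩ := eventually_atTop.1
    (((tendsto_rpow_atTop hq).const_mul_atTop (cN_pos hn)).eventually_ge_atTop (M + K0 n))
  refine ⟨max B 1, fun T => ?_⟩
  by_contra! hcon
  set s : ℝ → ℝ := fun t => sin (t - T) with hs
  set c : ℝ → ℝ := fun t => cos (t - T) with hc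
  have ds (t : ℝ) : HasDerivAt s (c t) t := by
    simpa using ((hasDerivAt_id t).sub_const T).sin
  have dc (t : ℝ) : HasDerivAt c (-s t) t := by
    simpa using ((hasDerivAt_id t).sub_const T).cos
  have hsc (t : ℝ) : c t ^ 2 = 1 - s t ^ 2 := by
    have := sin_sq_add_cos_sq (t - T)
    simp only [hs, hc]
    linarith
  have d0 (t : ℝ) : HasDerivAt (fun t => s t ^ 6) (6 * s t ^ 5 * c t) t := by
    refine ((ds t).pow 6).congr_deriv ?_
    norm_num
  have d1 (t : ℝ) : HasDerivAt (fun t => 6 * s t ^ 5 * c t) (30 * s t ^ 4 - 36 * s t ^ 6) t := by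
    refine ((((ds t).pow 5).const_mul 6).mul (dc t)).congr_deriv ?_
    norm_num
    linear_combination (30 * s t ^ 4) * hsc t
  have d2 (t : ℝ) : HasDerivAt (fun t => 30 * s t ^ 4 - 36 * s t ^ 6)
      (120 * s t ^ 3 * c t - 216 * s t ^ 5 * c t) t := by
    refine ((((ds t).pow 4).const_mul 30).sub (((ds t).pow 6).const_mul 36)).congr_deriv ?_
    norm_num
    ring
  have d3 (t : ℝ) : HasDerivAt (fun t => 120 * s t ^ 3 * c t - 216 * s t ^ 5 * c t)
      (360 * s t ^ 2 - 1560 * s t ^ 4 + 1296 * s t ^ 6) t := by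
    refine (((((ds t).pow 3).const_mul 120).mul (dc t)).sub
      ((((ds t).pow 5).const_mul 216).mul (dc t))).congr_deriv ?_
    norm_num
    linear_combination (360 * s t ^ 2 - 1080 * s t ^ 4) * hsc t
  have d4 (t : ℝ) : HasDerivAt (fun t => 360 * s t ^ 2 - 1560 * s t ^ 4 + 1296 * s t ^ 6)
      (720 * s t * c t - 6240 * s t ^ 3 * c t + 7776 * s t ^ 5 * c t) t := by
    refine (((((ds t).pow 2).const_mul 360).sub (((ds t).pow 4).const_mul 1560)).add
      (((ds t).pow 6).const_mul 1296)).congr_deriv ?_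
    norm_num
    ring
  have d5 (t : ℝ) : HasDerivAt
      (fun t => 720 * s t * c t - 6240 * s t ^ 3 * c t + 7776 * s t ^ 5 * c t)
      (720 - 20160 * s t ^ 2 + 63840 * s t ^ 4 - 46656 * s t ^ 6) t := by
    refine (((((ds t).const_mul 720).mul (dc t)).sub
      ((((ds t).pow 3).const_mul 6240).mul (dc t))).add
      ((((ds t).pow 5).const_mul 7776).mul (dc t))).congr_deriv ?_
    norm_num
    linear_combination (720 - 18720 * s t ^ 2 + 38880 * s t ^ 4) * hsc t
  have e0 (t : ℝ) := hv.hasDerivAt_iteratedDeriv (k := 0) (by norm_num) t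
  have e1 (t : ℝ) := hv.hasDerivAt_iteratedDeriv (k := 1) (by norm_num) t
  have e2 (t : ℝ) := hv.hasDerivAt_iteratedDeriv (k := 2) (by norm_num) t
  have e3 (t : ℝ) := hv.hasDerivAt_iteratedDeriv (k := 3) (by norm_num) t
  have e4 (t : ℝ) := hv.hasDerivAt_iteratedDeriv (k := 4) (by norm_num) t
  have e5 (t : ℝ) := hv.hasDerivAt_iteratedDeriv (k := 5) (by norm_num) t
  have dW (t : ℝ) := (((((((e5 t).mul (d0 t)).sub ((e4 t).mul (d1 t))).add
    ((e3 t).mul (d2 t))).sub ((e2 t).mul (d3 t))).add ((e1 t).mul (d4 t))).sub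
    ((e0 t).mul (d5 t))).sub
    ((((((e3 t).mul (d0 t)).sub ((e2 t).mul (d1 t))).add ((e1 t).mul (d2 t))).sub
      ((e0 t).mul (d3 t))).const_mul (K4 n)) |>.add
    ((((e1 t).mul (d0 t)).sub ((e0 t).mul (d1 t))).const_mul (K2 n))
  have hanti := strictAntiOn_of_deriv_neg (convex_Icc T (T + π))
    (fun t _ => (dW t).continuousAt.continuousWithinAt) (fun t ht => by
      rw [(dW t).deriv]
      have hvt := hcon t (interior_subset ht)
      have hBv : B ≤ v t := (le_max_left _ _).trans hvt
      have hvpos : 0 < v t := lt_of_lt_of_le one_pos ((le_max_right _ _).trans hvt)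
      have hode := hv.2 t
      rw [abs_of_pos hvpos] at hode
      have hx1 : s t ^ 2 ≤ 1 := sin_sq_le_one _
      have h1 := mul_pos hvpos (hM (s t ^ 2) (sq_nonneg _) hx1)
      have h2 := mul_nonneg (mul_nonneg (sub_nonneg.2 (hB (v t) hBv)) hvpos.le)
        (by positivity : 0 ≤ s t ^ 6)
      norm_num
      linear_combination h1 + h2 + s t ^ 6 * hode)
  have hlt := hanti (Set.left_mem_Icc.2 (by linarith [pi_pos]))
    (Set.right_mem_Icc.2 (by linarith [pi_pos])) (by linarith [pi_pos])
  simp [hs] at hlt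

theorem IsSolO6.not_tendsto_atTop {n : ℕ} (hn : 7 ≤ n) {v : ℝ → ℝ} (hv : IsSolO6 n v) :
    ¬ Tendsto v atTop atTop ∧ ¬ Tendsto v atBot atTop := by
  obtain ⟨B, hB⟩ := hv.exists_lt_on_Icc hn
  constructor <;> intro h
  · obtain ⟨T, hT⟩ := eventually_atTop.1 (h.eventually_ge_atTop B)
    obtain ⟨t, ht, hlt⟩ := hB T
    exact absurd (hT t ht.1) (not_le.2 hlt)
  · obtain ⟨T, hT⟩ := eventually_atBot.1 (h.eventually_ge_atTop B)
    obtain ⟨t, ht, hlt⟩ := hB (T - π)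
    exact absurd (hT t (by linarith [ht.2])) (not_le.2 hlt)

theorem no_infinite_limits_of_O6_solutions
    (n : ℕ) (hn : 7 ≤ n) (v : ℝ → ℝ) (hv : IsSolO6 n v) :
    (¬ Tendsto v atTop atTop) ∧ (¬ Tendsto v atTop atBot) ∧
    (¬ Tendsto v atBot atTop) ∧ (¬ Tendsto v atBot atBot) ∧
    (∀ ℓ : EReal, Tendsto (fun t => (v t : EReal)) atTop (nhds ℓ) → ∃ r : ℝ, ℓ = (r : EReal)) ∧
    (∀ ℓ : EReal, Tendsto (fun t => (v t : EReal)) atBot (nhds ℓ) → ∃ r : ℝ, ℓ = (r : EReal)) := by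
  obtain ⟨h1, h2⟩ := hv.not_tendsto_atTop hn
  obtain ⟨h3, h4⟩ := hv.neg.not_tendsto_atTop hn
  have h3' : ¬ Tendsto v atTop atBot := fun h => h3 (tendsto_neg_atBot_atTop.comp h)
  have h4' : ¬ Tendsto v atBot atBot := fun h => h4 (tendsto_neg_atBot_atTop.comp h)
  refine ⟨h1, h3', h2, h4', fun ℓ h => ?_, fun ℓ h => ?_⟩
  · induction ℓ with
    | bot => exact absurd (EReal.tendsto_coe_nhds_bot_iff.1 h) h3'
    | coe r => exact ⟨r, rfl⟩
    | top => exact absurd (EReal.tendsto_coe_nhds_top_iff.1 h) h1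
  · induction ℓ with
    | bot => exact absurd (EReal.tendsto_coe_nhds_bot_iff.1 h) h4'
    | coe r => exact ⟨r, rfl⟩
    | top => exact absurd (EReal.tendsto_coe_nhds_top_iff.1 h) h2
end
end
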